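/- arXiv:2307.13904 — 2 statements merged into one kernel-verified Lean document; each statement's English description precedes it below -/
import Mathlib

section
/- Each element g_I (I ⊆ {1, …, r}) lies in ker δ, and ker δ decomposes as an internal direct sum of 𝔽_p-vector spaces: ker δ = span_{𝔽_p}{g_I : I ⊆ {1, …, r}} ⊕ Im δ. -/
/-!
Context: `p` a prime, `r ≥ 1`, `k : Fin r → ℕ` with `k i ≥ 1`.
`A = 𝔽_p[y_1,…,y_r]/⟨y_1^{k_1},…,y_r^{k_r}⟩` is the truncated polynomial algebra,
`C` is the free `A`-module on the basis `θ_I` indexed by the subsets `I ⊆ {1,…,r}`,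
and `δ` is the Koszul differential, `δ(θ_I) = Σ_s (−1)^{s−1} y_{i_s} θ_{I∖{i_s}}`.
-/

set_option synthInstance.maxHeartbeats 1000000
set_option maxHeartbeats 1000000

noncomputable section

open scoped BigOperators

/-- The truncated polynomial algebra `A = 𝔽_p[y_1,…,y_r]/⟨y_1^{k_1},…,y_r^{k_r}⟩`. -/
abbrev KoszulA (p r : ℕ) (k : Fin r → ℕ) : Type :=
  MvPolynomial (Fin r) (ZMod p) ⧸
    Ideal.span (Set.range fun i : Fin r =>
      (MvPolynomial.X i : MvPolynomial (Fin r) (ZMod p)) ^ k i)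

/-- The element `y_i ∈ A`. -/
def Ky (p r : ℕ) (k : Fin r → ℕ) (i : Fin r) : KoszulA p r k :=
  Ideal.Quotient.mk _ (MvPolynomial.X i)

/-- The Koszul complex `C`: the free `A`-module with basis `θ_I`, `I ⊆ {1,…,r}`. -/
abbrev KoszulC (p r : ℕ) (k : Fin r → ℕ) : Type :=
  Finset (Fin r) →₀ KoszulA p r k

/-- The basis element `θ_I` (with `θ_∅ = 1`). -/
def Ktheta (p r : ℕ) (k : Fin r → ℕ) (I : Finset (Fin r)) : KoszulC p r k :=
  Finsupp.single I 1

/-- The value `δ(θ_I) = Σ_{s} (−1)^{s−1} y_{i_s}·θ_{I∖{i_s}}`, the exponent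
`(I.filter (· < i)).card` being exactly `s − 1` for the `s`-th smallest element `i` of `I`. -/
def KdeltaTheta (p r : ℕ) (k : Fin r → ℕ) (I : Finset (Fin r)) : KoszulC p r k :=
  ∑ i ∈ I, ((-1 : KoszulA p r k) ^ (I.filter fun j => j < i).card * Ky p r k i) •
    Ktheta p r k (I.erase i)

/-- The Koszul differential `δ : C → C`: the `A`-linear map determined on the basis by
`δ(θ_I) = Σ_{s} (−1)^{s−1} y_{i_s}·θ_{I∖{i_s}}`. -/
def Kdelta (p r : ℕ) (k : Fin r → ℕ) : KoszulC p r k →ₗ[KoszulA p r k] KoszulC p r k :=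
  Finsupp.lsum (KoszulA p r k) fun I =>
    LinearMap.toSpanSingleton (KoszulA p r k) (KoszulC p r k) (KdeltaTheta p r k I)

/-- `δ`, viewed as an `𝔽_p`-linear map. -/
def Kdelta' (p r : ℕ) (k : Fin r → ℕ) : KoszulC p r k →ₗ[ZMod p] KoszulC p r k :=
  (Kdelta p r k).restrictScalars (ZMod p)

/-- The element `g_I = (Π_{i∈I} y_i^{k_i−1})·θ_I` (so `g_∅ = 1`). -/
def Kg (p r : ℕ) (k : Fin r → ℕ) (I : Finset (Fin r)) : KoszulC p r k :=
  (∏ i ∈ I, Ky p r k i ^ (k i - 1)) • Ktheta p r k I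

/-- The `𝔽_p`-generator `y^a θ_I` of the Koszul complex. -/
def Kmono (p r : ℕ) (k : Fin r → ℕ) (a : Fin r →₀ ℕ) (I : Finset (Fin r)) : KoszulC p r k :=
  Finsupp.single I (Ideal.Quotient.mk _ (MvPolynomial.monomial a 1))

/-- The sign `(−1)^{s−1}` attached to the position of `i` in `I`. -/
def Ksign (p : ℕ) {r : ℕ} (I : Finset (Fin r)) (i : Fin r) : ZMod p :=
  (-1) ^ (I.filter fun j => j < i).card

/-- The multidegree of `y^a θ_I`, where `θ_i` is given the degree of `y_i`. -/
def Kdeg {r : ℕ} (a : Fin r →₀ ℕ) (I : Finset (Fin r)) (i : Fin r) : ℕ :=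
  a i + if i ∈ I then 1 else 0

/-- The coordinates at which a multidegree lies strictly between `0` and `k`. -/
def Kfree {r : ℕ} (k m : Fin r → ℕ) : Finset (Fin r) :=
  Finset.univ.filter fun i => 0 < m i ∧ m i < k i

lemma mem_Kfree {r : ℕ} {k m : Fin r → ℕ} {i : Fin r} :
    i ∈ Kfree k m ↔ 0 < m i ∧ m i < k i := by
  simp [Kfree]

lemma Kdeg_add_single_erase {r : ℕ} (a : Fin r →₀ ℕ) {I : Finset (Fin r)} {i : Fin r}
    (hi : i ∈ I) : Kdeg (a + Finsupp.single i 1) (I.erase i) = Kdeg a I := by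
  funext j
  by_cases hj : j = i
  · subst hj
    simp [Kdeg, hi]
  · simp [Kdeg, hj]

lemma Ksign_mul_self (p : ℕ) {r : ℕ} (I : Finset (Fin r)) (i : Fin r) :
    Ksign p I i * Ksign p I i = 1 := by
  rw [Ksign, ← mul_pow]
  simp

lemma Ksign_erase_self (p : ℕ) {r : ℕ} (I : Finset (Fin r)) (i : Fin r) :
    Ksign p (I.erase i) i = Ksign p I i := by
  have : ((I.erase i).filter fun j => j < i) = I.filter fun j => j < i := by
    ext j
    simp only [Finset.mem_filter, Finset.mem_erase]
    grind
  rw [Ksign, Ksign, this]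

lemma Ksign_insert_self (p : ℕ) {r : ℕ} (I : Finset (Fin r)) (i : Fin r) :
    Ksign p (insert i I) i = Ksign p I i := by
  have : ((insert i I).filter fun j => j < i) = I.filter fun j => j < i := by
    ext j
    simp only [Finset.mem_filter, Finset.mem_insert]
    grind
  rw [Ksign, Ksign, this]

lemma Ksign_insert (p : ℕ) {r : ℕ} {I : Finset (Fin r)} {i : Fin r} (hi : i ∉ I) (j : Fin r) :
    Ksign p (insert i I) j = (if i < j then -1 else 1) * Ksign p I j := by
  rw [Ksign, Ksign, Finset.filter_insert]
  split_ifs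
  · rw [Finset.card_insert_of_notMem (by simp [hi]), pow_succ']
  · rw [one_mul]

lemma Ksign_anticomm (p : ℕ) {r : ℕ} {I : Finset (Fin r)} {i j : Fin r} (hi : i ∉ I)
    (hj : j ∈ I) :
    Ksign p I j * Ksign p (I.erase j) i = -(Ksign p I i * Ksign p (insert i I) j) := by
  have hne : i ≠ j := fun h => hi (h ▸ hj)
  have h := Ksign_insert p (Finset.notMem_erase j I) i
  rw [Finset.insert_erase hj] at h
  rw [Ksign_insert p hi, h]
  rcases lt_or_gt_of_ne hne with hlt | hlt
  · simp only [hlt, hlt.not_gt, if_true, if_false]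
    ring
  · simp only [hlt, hlt.not_gt, if_true, if_false]
    ring

lemma Ksign_erase_anticomm (p : ℕ) {r : ℕ} {I : Finset (Fin r)} {i j : Fin r} (hi : i ∈ I)
    (hj : j ∈ I) (hij : i ≠ j) :
    Ksign p I i * Ksign p (I.erase i) j = -(Ksign p I j * Ksign p (I.erase j) i) := by
  have h₁ := Ksign_insert p (Finset.notMem_erase j I) i
  have h₂ := Ksign_insert p (Finset.notMem_erase i I) j
  rw [Finset.insert_erase hj] at h₁
  rw [Finset.insert_erase hi] at h₂
  rw [h₁, h₂]
  rcases lt_or_gt_of_ne hij with hlt | hlt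
  · simp only [hlt, hlt.not_gt, if_true, if_false]
    ring
  · simp only [hlt, hlt.not_gt, if_true, if_false]
    ring

section

variable {p r : ℕ} {k : Fin r → ℕ}

lemma Kmono_eq_zero {a : Fin r →₀ ℕ} {i : Fin r} (h : k i ≤ a i) (I : Finset (Fin r)) :
    Kmono p r k a I = 0 := by
  rw [Kmono, Finsupp.single_eq_zero, Ideal.Quotient.eq_zero_iff_mem]
  have ha : (MvPolynomial.monomial a 1 : MvPolynomial (Fin r) (ZMod p)) =
      MvPolynomial.monomial (a - Finsupp.single i (k i)) 1 * MvPolynomial.X i ^ k i := by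
    rw [MvPolynomial.X_pow_eq_monomial, MvPolynomial.monomial_mul, one_mul,
      tsub_add_cancel_of_le (by simpa using h)]
  rw [ha]
  exact Ideal.mul_mem_left _ _ (Ideal.subset_span ⟨i, rfl⟩)

lemma span_Kmono :
    Submodule.span (ZMod p) (Set.range fun x : (Fin r →₀ ℕ) × Finset (Fin r) =>
      Kmono p r k x.1 x.2) = ⊤ := by
  rw [eq_top_iff]
  rintro x -
  induction x using Finsupp.induction_linear with
  | zero => exact zero_mem _
  | add x y hx hy => exact add_mem hx hy
  | single I c =>
    obtain ⟨f, rfl⟩ := Ideal.Quotient.mk_surjective c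
    induction f using MvPolynomial.induction_on' with
    | monomial a c =>
      have : (Finsupp.single I (Ideal.Quotient.mk _ (MvPolynomial.monomial a c)) :
          KoszulC p r k) = c • Kmono p r k a I := by
        rw [Kmono, Finsupp.smul_single, ← Ideal.Quotient.mkₐ_eq_mk (ZMod p), ← map_smul,
          MvPolynomial.smul_monomial, smul_eq_mul, mul_one]
      rw [this]
      exact Submodule.smul_mem _ _ (Submodule.subset_span ⟨(a, I), rfl⟩)
    | add f g hf hg =>
      rw [map_add, Finsupp.single_add]
      exact add_mem hf hg

lemma Kmono_hom_ext {N : Type*} [AddCommGroup N] [Module (ZMod p) N]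
    {f g : KoszulC p r k →ₗ[ZMod p] N}
    (h : ∀ a I, f (Kmono p r k a I) = g (Kmono p r k a I)) : f = g :=
  LinearMap.ext_on span_Kmono (by rintro _ ⟨x, rfl⟩; exact h x.1 x.2)

/-- An `𝔽_p`-linear map out of the Koszul complex can be prescribed on the `y^a θ_I`, provided it
kills those with some `a_i ≥ k_i`. -/
lemma exists_linearMap_Kmono {N : Type*} [AddCommGroup N] [Module (ZMod p) N]
    (f : (Fin r →₀ ℕ) → Finset (Fin r) → N) (hf : ∀ a I i, k i ≤ a i → f a I = 0) :
    ∃ F : KoszulC p r k →ₗ[ZMod p] N, ∀ a I, F (Kmono p r k a I) = f a I := by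
  have key : ∀ I, ∃ F : KoszulA p r k →ₗ[ZMod p] N,
      ∀ a, F (Ideal.Quotient.mk _ (MvPolynomial.monomial a 1)) = f a I := by
    intro I
    let J := Ideal.span (Set.range fun i : Fin r =>
      (MvPolynomial.X i : MvPolynomial (Fin r) (ZMod p)) ^ k i)
    let φ : MvPolynomial (Fin r) (ZMod p) →ₗ[ZMod p] N :=
      (MvPolynomial.basisMonomials (Fin r) (ZMod p)).constr (ZMod p) fun a => f a I
    have hφ : ∀ a, φ (MvPolynomial.monomial a 1) = f a I := fun a => by
      have := (MvPolynomial.basisMonomials (Fin r) (ZMod p)).constr_basis (ZMod p)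
        (fun a => f a I) a
      rwa [MvPolynomial.coe_basisMonomials] at this
    have hJ : J.restrictScalars (ZMod p) ≤ LinearMap.ker φ := by
      intro x hx
      have hx' : x ∈ J := hx
      refine Submodule.span_induction (p := fun x _ => φ x = 0) ?_ (map_zero φ)
        (fun x y _ _ hx hy => by rw [map_add, hx, hy, add_zero]) ?_
        ((Ideal.mem_span_range_iff_exists_fun.mp hx').elim fun c hc => ?_ :
          x ∈ Submodule.span (ZMod p) {y | ∃ a i, k i ≤ a i ∧ y = MvPolynomial.monomial a 1})
      · rintro _ ⟨a, i, h, rfl⟩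
        rw [hφ, hf a I i h]
      · intro c x _ hx
        rw [map_smul, hx, smul_zero]
      · rw [← hc]
        refine sum_mem fun i _ => ?_
        induction c i using MvPolynomial.induction_on' with
        | monomial a c =>
          rw [MvPolynomial.X_pow_eq_monomial, MvPolynomial.monomial_mul, mul_one,
            ← mul_one c, ← smul_eq_mul, ← MvPolynomial.smul_monomial]
          exact Submodule.smul_mem _ _ (Submodule.subset_span ⟨_, i, by simp, rfl⟩)
        | add f g hf hg =>
          rw [add_mul]
          exact add_mem hf hg
    exact ⟨((J.restrictScalars (ZMod p)).liftQ φ hJ).comp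
      (Submodule.Quotient.restrictScalarsEquiv (ZMod p) J).symm.toLinearMap, hφ⟩
  choose F hF using key
  exact ⟨Finsupp.lsum (ZMod p) F, fun a I => by rw [Kmono, Finsupp.lsum_single, hF]⟩

lemma Kdelta'_Kmono (a : Fin r →₀ ℕ) (I : Finset (Fin r)) :
    Kdelta' p r k (Kmono p r k a I) =
      ∑ i ∈ I, Ksign p I i • Kmono p r k (a + Finsupp.single i 1) (I.erase i) := by
  rw [Kdelta', LinearMap.restrictScalars_apply, Kdelta, Kmono, Finsupp.lsum_single,
    LinearMap.toSpanSingleton_apply, KdeltaTheta, Finset.smul_sum]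
  refine Finset.sum_congr rfl fun i _ => ?_
  rw [Kmono, Ktheta, Finsupp.smul_single, Finsupp.smul_single, Finsupp.smul_single]
  congr 1
  refine Eq.trans ?_ (Algebra.smul_def (Ksign p I i) (_ : KoszulA p r k)).symm
  have hmul : (MvPolynomial.monomial (a + Finsupp.single i 1) 1 :
      MvPolynomial (Fin r) (ZMod p)) = MvPolynomial.monomial a 1 * MvPolynomial.X i := by
    rw [MvPolynomial.X, MvPolynomial.monomial_mul, one_mul]
  rw [hmul, Ksign, map_pow, map_neg, map_one (algebraMap (ZMod p) (KoszulA p r k)), Ky,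
    smul_eq_mul, smul_eq_mul, mul_one, map_mul]
  ring

lemma Kg_eq_Kmono (I : Finset (Fin r)) :
    Kg p r k I = Kmono p r k (∑ i ∈ I, Finsupp.single i (k i - 1)) I := by
  rw [Kg, Kmono, Ktheta, Finsupp.smul_single, smul_eq_mul, mul_one, MvPolynomial.monomial_sum_one,
    map_prod]
  congr 1
  refine Finset.prod_congr rfl fun i _ => ?_
  rw [Ky, ← map_pow, MvPolynomial.X_pow_eq_monomial]

lemma sum_single_apply (I : Finset (Fin r)) (j : Fin r) :
    (∑ i ∈ I, Finsupp.single i (k i - 1)) j = if j ∈ I then k j - 1 else 0 := by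
  simp only [Finsupp.finsetSum_apply, Finsupp.single_apply]
  exact Finset.sum_ite_eq' I j _

lemma Kfree_Kdeg_Kg (I : Finset (Fin r)) :
    Kfree k (Kdeg (∑ i ∈ I, Finsupp.single i (k i - 1)) I) = ∅ := by
  ext j
  rw [mem_Kfree, Kdeg, sum_single_apply]
  simp only [Finset.notMem_empty, iff_false]
  split_ifs <;> omega

lemma Kmono_mem_span_Kg {a : Fin r →₀ ℕ} {I : Finset (Fin r)}
    (h : ¬(Kfree k (Kdeg a I)).Nonempty) :
    Kmono p r k a I ∈ Submodule.span (ZMod p) (Set.range (Kg p r k)) := by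
  by_cases ha : ∃ i, k i ≤ a i
  · obtain ⟨i, hi⟩ := ha
    rw [Kmono_eq_zero hi]
    exact zero_mem _
  · push Not at ha
    refine Submodule.subset_span ⟨I, ?_⟩
    rw [Kg_eq_Kmono]
    congr 1
    ext j
    rw [sum_single_apply]
    have hj : j ∉ Kfree k (Kdeg a I) := fun hj => h ⟨j, hj⟩
    rw [mem_Kfree, Kdeg] at hj
    have := ha j
    split_ifs at hj ⊢ <;> omega

lemma exists_Khomotopy (p : ℕ) (k : Fin r → ℕ) :
    ∃ H : KoszulC p r k →ₗ[ZMod p] KoszulC p r k, ∀ a I, H (Kmono p r k a I) =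
      if h : (Kfree k (Kdeg a I)).Nonempty then
        if (Kfree k (Kdeg a I)).min' h ∈ I then 0 else
          Ksign p I ((Kfree k (Kdeg a I)).min' h) •
            Kmono p r k (a - Finsupp.single ((Kfree k (Kdeg a I)).min' h) 1)
              (insert ((Kfree k (Kdeg a I)).min' h) I)
      else 0 := by
  refine exists_linearMap_Kmono _ fun a I i hi => ?_
  split_ifs with h h'
  · rfl
  · have hm := (mem_Kfree.mp (Finset.min'_mem _ h)).2
    generalize (Kfree k (Kdeg a I)).min' h = m at hm
    have him : i ≠ m := by
      rintro rfl
      rw [Kdeg] at hm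
      omega
    rw [Kmono_eq_zero (i := i), smul_zero]
    simpa [him.symm] using hi
  · rfl

lemma exists_Kprojection (p : ℕ) (k : Fin r → ℕ) :
    ∃ P : KoszulC p r k →ₗ[ZMod p] KoszulC p r k, ∀ a I, P (Kmono p r k a I) =
      if (Kfree k (Kdeg a I)).Nonempty then 0 else Kmono p r k a I := by
  refine exists_linearMap_Kmono _ fun a I i hi => ?_
  rw [Kmono_eq_zero hi, ite_self]

/-- The projection onto `span {g_I}` is chain homotopic to the identity and kills boundaries. -/
lemma exists_Kcontraction (p : ℕ) (k : Fin r → ℕ) :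
    ∃ H P : KoszulC p r k →ₗ[ZMod p] KoszulC p r k,
      (∀ x, Kdelta' p r k (H x) + H (Kdelta' p r k x) + P x = x) ∧
      (∀ x, P (Kdelta' p r k x) = 0) ∧
      (∀ x, P x ∈ Submodule.span (ZMod p) (Set.range (Kg p r k))) ∧
      ∀ I, P (Kg p r k I) = Kg p r k I := by
  obtain ⟨H, hH⟩ := exists_Khomotopy p k
  obtain ⟨P, hP⟩ := exists_Kprojection p k
  refine ⟨H, P, ?_, ?_, ?_, ?_⟩
  · refine LinearMap.congr_fun (f := Kdelta' p r k ∘ₗ H + H ∘ₗ Kdelta' p r k + P)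
      (g := LinearMap.id) (Kmono_hom_ext fun a I => ?_)
    simp only [LinearMap.add_apply, LinearMap.comp_apply, LinearMap.id_apply]
    have hHδ : H (Kdelta' p r k (Kmono p r k a I)) =
        ∑ j ∈ I, Ksign p I j • H (Kmono p r k (a + Finsupp.single j 1) (I.erase j)) := by
      rw [Kdelta'_Kmono, map_sum]
      simp only [map_smul]
    rw [hHδ, hP]
    by_cases hF : (Kfree k (Kdeg a I)).Nonempty
    · rw [if_pos hF, add_zero]
      have hH' : ∀ b J, Kdeg b J = Kdeg a I → H (Kmono p r k b J) =
          if (Kfree k (Kdeg a I)).min' hF ∈ J then 0 else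
            Ksign p J ((Kfree k (Kdeg a I)).min' hF) •
              Kmono p r k (b - Finsupp.single ((Kfree k (Kdeg a I)).min' hF) 1)
                (insert ((Kfree k (Kdeg a I)).min' hF) J) := by
        intro b J hbJ
        rw [hH]
        simp only [hbJ]
        rw [dif_pos hF]
      have hm := mem_Kfree.mp (Finset.min'_mem _ hF)
      generalize (Kfree k (Kdeg a I)).min' hF = m at hm hH'
      rw [hH' a I rfl, Finset.sum_congr rfl fun j hj => by
        rw [hH' _ _ (Kdeg_add_single_erase a hj)]]
      by_cases hmI : m ∈ I
      · rw [if_pos hmI, map_zero, zero_add, Finset.sum_eq_single_of_mem m hmI]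
        · rw [if_neg (Finset.notMem_erase m I), Ksign_erase_self, smul_smul, Ksign_mul_self,
            one_smul, add_tsub_cancel_right, Finset.insert_erase hmI]
        · intro j _ hjm
          rw [if_pos (Finset.mem_erase.mpr ⟨hjm.symm, hmI⟩), smul_zero]
      · have ham : Finsupp.single m 1 ≤ a := by
          rw [Finsupp.single_le_iff]
          simpa [Kdeg, hmI, Nat.one_le_iff_ne_zero, Nat.pos_iff_ne_zero] using hm.1
        rw [if_neg hmI, map_smul, Kdelta'_Kmono, Finset.sum_insert hmI, smul_add,
          Ksign_insert_self, smul_smul, Ksign_mul_self, one_smul, Finset.erase_insert hmI,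
          tsub_add_cancel_of_le ham, add_assoc, Finset.smul_sum, ← Finset.sum_add_distrib,
          Finset.sum_eq_zero, add_zero]
        intro j hj
        have hjm : m ≠ j := fun h => hmI (h ▸ hj)
        rw [if_neg (fun h => hmI (Finset.mem_of_mem_erase h)), smul_smul, smul_smul,
          Ksign_anticomm p hmI hj, Finset.erase_insert_of_ne hjm, tsub_add_eq_add_tsub ham,
          ← add_smul, add_neg_cancel, zero_smul]
    · rw [if_neg hF, hH, dif_neg hF, map_zero, zero_add, Finset.sum_eq_zero, zero_add]
      intro j hj
      rw [hH, Kdeg_add_single_erase a hj, dif_neg hF, smul_zero]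
  · refine LinearMap.congr_fun (f := P ∘ₗ Kdelta' p r k) (g := 0) (Kmono_hom_ext fun a I => ?_)
    rw [LinearMap.comp_apply, Kdelta'_Kmono, map_sum, LinearMap.zero_apply]
    refine Finset.sum_eq_zero fun j hj => ?_
    rw [map_smul, hP, Kdeg_add_single_erase a hj]
    split_ifs with hF
    · exact smul_zero _
    · rw [Kmono_eq_zero (i := j), smul_zero]
      have hjF : j ∉ Kfree k (Kdeg a I) := fun h => hF ⟨j, h⟩
      rw [mem_Kfree, Kdeg, if_pos hj] at hjF
      simp only [Finsupp.add_apply, Finsupp.single_eq_same]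
      omega
  · intro x
    have hx : x ∈ Submodule.span (ZMod p) (Set.range fun x : (Fin r →₀ ℕ) × Finset (Fin r) =>
        Kmono p r k x.1 x.2) := span_Kmono ▸ Submodule.mem_top
    revert x
    change _ ≤ (Submodule.span (ZMod p) (Set.range (Kg p r k))).comap P
    rw [Submodule.span_le]
    rintro _ ⟨⟨a, I⟩, rfl⟩
    rw [SetLike.mem_coe, Submodule.mem_comap, hP]
    split_ifs with hF
    · exact zero_mem _
    · exact Kmono_mem_span_Kg hF
  · intro I
    rw [Kg_eq_Kmono, hP, if_neg]
    rw [Kfree_Kdeg_Kg]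
    exact Finset.not_nonempty_empty

lemma Kdelta'_Kg (hk : ∀ i, 1 ≤ k i) (I : Finset (Fin r)) : Kdelta' p r k (Kg p r k I) = 0 := by
  rw [Kg_eq_Kmono, Kdelta'_Kmono]
  refine Finset.sum_eq_zero fun i hi => ?_
  rw [Kmono_eq_zero (i := i), smul_zero]
  rw [Finsupp.add_apply, sum_single_apply, if_pos hi, Finsupp.single_eq_same]
  have := hk i
  omega

lemma Kdelta'_Kdelta' (x : KoszulC p r k) : Kdelta' p r k (Kdelta' p r k x) = 0 := by
  revert x
  refine LinearMap.congr_fun (f := Kdelta' p r k ∘ₗ Kdelta' p r k) (g := 0)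
    (Kmono_hom_ext fun a I => ?_)
  rw [LinearMap.comp_apply, Kdelta'_Kmono, map_sum, LinearMap.zero_apply]
  simp only [map_smul, Kdelta'_Kmono, Finset.smul_sum, smul_smul]
  rw [Finset.sum_sigma']
  refine Finset.sum_involution (fun x _ => ⟨x.2, x.1⟩) ?_ ?_ ?_ (fun _ _ => rfl)
  · rintro ⟨i, j⟩ hx
    obtain ⟨hi, hj⟩ := Finset.mem_sigma.mp hx
    obtain ⟨hji, hj⟩ := Finset.mem_erase.mp hj
    dsimp only at hi hj hji ⊢
    rw [Ksign_erase_anticomm p hi hj hji.symm, Finset.erase_right_comm, add_right_comm,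
      ← add_smul, neg_add_cancel, zero_smul]
  · rintro ⟨i, j⟩ hx _ h
    obtain ⟨-, hj⟩ := Finset.mem_sigma.mp hx
    exact (Finset.mem_erase.mp hj).1 (congrArg Sigma.fst h)
  · rintro ⟨i, j⟩ hx
    simp only [Finset.mem_sigma, Finset.mem_erase] at hx ⊢
    exact ⟨hx.2.2, hx.2.1.symm, hx.1⟩

end

/-- Each element `g_I` (`I ⊆ {1,…,r}`) lies in `ker δ`, and `ker δ`
decomposes as an internal direct sum of `𝔽_p`-vector spaces
`ker δ = span_{𝔽_p}{g_I : I ⊆ {1,…,r}} ⊕ Im δ`. -/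
theorem statement3 (p : ℕ) (hp : p.Prime) (r : ℕ) (hr : 1 ≤ r)
    (k : Fin r → ℕ) (hk : ∀ i, 1 ≤ k i) :
    (∀ I : Finset (Fin r), Kg p r k I ∈ LinearMap.ker (Kdelta' p r k)) ∧
    LinearMap.ker (Kdelta' p r k) =
      Submodule.span (ZMod p) (Set.range (Kg p r k)) ⊔ LinearMap.range (Kdelta' p r k) ∧
    Submodule.span (ZMod p) (Set.range (Kg p r k)) ⊓ LinearMap.range (Kdelta' p r k) = ⊥ := by
  obtain ⟨H, P, hHP, hPδ, hPmem, hPg⟩ := exists_Kcontraction p k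
  have hg : Submodule.span (ZMod p) (Set.range (Kg p r k)) ≤ LinearMap.ker (Kdelta' p r k) := by
    rw [Submodule.span_le]
    rintro _ ⟨I, rfl⟩
    exact Kdelta'_Kg hk I
  refine ⟨fun I => Kdelta'_Kg hk I, le_antisymm ?_ (sup_le hg ?_), ?_⟩
  · intro x hx
    have h := hHP x
    rw [LinearMap.mem_ker.mp hx, map_zero, add_zero, add_comm] at h
    rw [← h]
    exact Submodule.add_mem_sup (hPmem x) ⟨H x, rfl⟩
  · rintro _ ⟨x, rfl⟩
    exact Kdelta'_Kdelta' x
  · rw [eq_bot_iff]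
    rintro x ⟨hx, y, rfl⟩
    have hfix : Submodule.span (ZMod p) (Set.range (Kg p r k)) ≤
        LinearMap.eqLocus P LinearMap.id := by
      rw [Submodule.span_le]
      rintro _ ⟨I, rfl⟩
      exact hPg I
    exact (hfix hx).symm.trans (hPδ y)

end
end

section
/- Im δ is a non-unital 𝔽_2-subalgebra of C (it is an A-submodule closed under the product of C), and the assignment Y_i ↦ y_i, c_I ↦ C_I induces an isomorphism of non-unital 𝔽_2-algebras P⁺/⟨Y_i^{k_i} (1 ≤ i ≤ r), R̃_J (|J| ≥ 2), D̃_K (|K| ≥ 3), S̃_{H,L} (|H|, |L| ≥ 2)⟩ ≅ Im δ, where P⁺ denotes the ideal of polynomials with zero constant term in the polynomial ring 𝔽_2[Y_i (1 ≤ i ≤ r), c_I (I ⊆ {1, …, r}, |I| ≥ 2)], and, with the conventions c_{{t}} := Y_t and c_∅ := 0, for J, K = {i_1 < ⋯ < i_{|K|}}, H = {h_1 < ⋯ < h_{|H|}}, L ⊆ {1, …, r} one sets R̃_J := (Π_{j∈J} Y_j^{k_j−1})·c_J, D̃_K := Σ_{s=1}^{|K|} Y_{i_s}·c_{K_s}, and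 S̃_{H,L} := c_H·c_L + Σ_{s=1}^{|H|} Y_{h_s}·b̃_{H_s∩L}·c_{H_s△L}, where H_s := H ∖ {h_s}, △ is symmetric difference, and b̃_M ∈ 𝔽_2[Y_1, …, Y_r] is any fixed polynomial mapping to b_M under Y_i ↦ y_i. -/
/-!
Context: `p = 2`, `r ≥ 1`, `k : Fin r → ℕ` with `k i ≥ 1`, and elements `b_1,…,b_r ∈ A`
(given by lifts `btil i ∈ 𝔽₂[y_1,…,y_r]`).  The Koszul complex `C`, endowed with the
algebra structure `θ_i² = b_i`, is the commutative `𝔽₂`-algebra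
`C = 𝔽₂[y_1,…,y_r,θ_1,…,θ_r]/⟨y_i^{k_i}, θ_i² − b_i⟩`;
here the variables `Sum.inl i` play the role of `y_i` and `Sum.inr i` that of `θ_i`.
In it, `θ_I = Π_{i∈I} θ_i`, `A` is the image of `𝔽₂[y_1,…,y_r]`,
`C_I := δ(θ_I) = Σ_{s=1}^{|I|} (−1)^{s−1} y_{i_s} θ_{I∖{i_s}}`, and
`Im δ` is the `A`-span of the `C_I`'s.
-/

set_option synthInstance.maxHeartbeats 1000000
set_option maxHeartbeats 1000000

noncomputable section

open MvPolynomial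

/-- The Koszul complex with its algebra structure:
`C = 𝔽₂[y_1,…,y_r,θ_1,…,θ_r]/⟨y_i^{k_i}, θ_i² − b_i : 1 ≤ i ≤ r⟩`. -/
abbrev KRing (r : ℕ) (k : Fin r → ℕ) (btil : Fin r → MvPolynomial (Fin r) (ZMod 2)) : Type :=
  MvPolynomial (Fin r ⊕ Fin r) (ZMod 2) ⧸
    Ideal.span
      ((Set.range fun i : Fin r =>
          (X (Sum.inl i) : MvPolynomial (Fin r ⊕ Fin r) (ZMod 2)) ^ k i) ∪
       (Set.range fun i : Fin r =>
          (X (Sum.inr i) : MvPolynomial (Fin r ⊕ Fin r) (ZMod 2)) ^ 2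
            - rename Sum.inl (btil i)))

variable (r : ℕ) (k : Fin r → ℕ) (btil : Fin r → MvPolynomial (Fin r) (ZMod 2))

/-- The element `y_i ∈ A ⊆ C`. -/
def ky (i : Fin r) : KRing r k btil := Ideal.Quotient.mk _ (X (Sum.inl i))

/-- The element `θ_i ∈ C`. -/
def kth (i : Fin r) : KRing r k btil := Ideal.Quotient.mk _ (X (Sum.inr i))

/-- The map `𝔽₂[Y_1,…,Y_r] → C`, `Y_i ↦ y_i`; its image is the subring `A ⊆ C`. -/
def yEval (q : MvPolynomial (Fin r) (ZMod 2)) : KRing r k btil :=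
  Ideal.Quotient.mk _ (rename Sum.inl q)

/-- The element `b_i = θ_i² ∈ A`. -/
def kb (i : Fin r) : KRing r k btil := yEval r k btil (btil i)

/-- `b_M := Π_{i∈M} b_i` (with `b_∅ = 1`). -/
def kbM (M : Finset (Fin r)) : KRing r k btil := ∏ i ∈ M, kb r k btil i

/-- The element `θ_I = Π_{i∈I} θ_i` (with `θ_∅ = 1`). -/
def kTheta (I : Finset (Fin r)) : KRing r k btil := ∏ i ∈ I, kth r k btil i

/-- The element `C_I := δ(θ_I) = Σ_{s=1}^{|I|} (−1)^{s−1} y_{i_s}·θ_{I∖{i_s}}`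
(so `C_∅ = 0` and `C_{{i}} = y_i`). -/
def kC (I : Finset (Fin r)) : KRing r k btil :=
  ∑ i ∈ I, (-1 : KRing r k btil) ^ (I.filter fun j => j < i).card *
    (ky r k btil i * kTheta r k btil (I.erase i))

/-- `Im δ ⊆ C`: the image of the Koszul differential, i.e. the `A`-span of the `C_I`'s. -/
def kIm : Submodule (ZMod 2) (KRing r k btil) :=
  Submodule.span (ZMod 2)
    {x : KRing r k btil | ∃ (q : MvPolynomial (Fin r) (ZMod 2)) (I : Finset (Fin r)),
      x = yEval r k btil q * kC r k btil I}

/-- The variables of the presenting polynomial ring: `Y_i` for `1 ≤ i ≤ r` (`Sum.inl`),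
and `c_I` for `I ⊆ {1,…,r}` with `|I| ≥ 2` (`Sum.inr`). -/
abbrev PVar (r : ℕ) : Type := Fin r ⊕ {I : Finset (Fin r) // 2 ≤ I.card}

/-- The polynomial ring `P = 𝔽₂[Y_i (1 ≤ i ≤ r), c_I (|I| ≥ 2)]`. -/
abbrev PRing (r : ℕ) : Type := MvPolynomial (PVar r) (ZMod 2)

/-- The polynomial `c_I ∈ P`, with the conventions `c_{{t}} := Y_t` and `c_∅ := 0`. -/
def cP (r : ℕ) (I : Finset (Fin r)) : PRing r :=
  if h : 2 ≤ I.card then X (Sum.inr ⟨I, h⟩) else ∑ t ∈ I, X (Sum.inl t)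

/-- The ideal `⟨Y_i^{k_i} (1 ≤ i ≤ r), R̃_J (|J| ≥ 2), D̃_K (|K| ≥ 3), S̃_{H,L} (|H|,|L| ≥ 2)⟩`
of relations, where `R̃_J := (Π_{j∈J} Y_j^{k_j−1})·c_J`,
`D̃_K := Σ_{s=1}^{|K|} Y_{i_s}·c_{K_s}` and
`S̃_{H,L} := c_H·c_L + Σ_{s=1}^{|H|} Y_{h_s}·b̃_{H_s∩L}·c_{H_s△L}`. -/
def relIdeal (r : ℕ) (k : Fin r → ℕ)
    (btilM : Finset (Fin r) → MvPolynomial (Fin r) (ZMod 2)) : Ideal (PRing r) :=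
  Ideal.span
    ((Set.range fun i : Fin r => (X (Sum.inl i) : PRing r) ^ k i) ∪
     {x : PRing r | ∃ J : Finset (Fin r), 2 ≤ J.card ∧
        x = (∏ j ∈ J, (X (Sum.inl j) : PRing r) ^ (k j - 1)) * cP r J} ∪
     {x : PRing r | ∃ K : Finset (Fin r), 3 ≤ K.card ∧
        x = ∑ i ∈ K, (X (Sum.inl i) : PRing r) * cP r (K.erase i)} ∪
     {x : PRing r | ∃ H L : Finset (Fin r), 2 ≤ H.card ∧ 2 ≤ L.card ∧
        x = cP r H * cP r L +
          ∑ i ∈ H, (X (Sum.inl i) : PRing r) *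
            rename (Sum.inl : Fin r → PVar r) (btilM ((H.erase i) ∩ L)) *
            cP r (symmDiff (H.erase i) L)})

/-- The ideal `P⁺ ⊆ P` of polynomials with zero constant term. -/
def Pplus (r : ℕ) : Ideal (PRing r) :=
  RingHom.ker (constantCoeff : PRing r →+* ZMod 2)

/-- The quotient ring `Q = P/⟨relations⟩`. -/
abbrev QRing (r : ℕ) (k : Fin r → ℕ)
    (btilM : Finset (Fin r) → MvPolynomial (Fin r) (ZMod 2)) : Type :=
  PRing r ⧸ relIdeal r k btilM

/-- The image of `P⁺` in `Q`; since the relation ideal is contained in `P⁺`, this is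
`P⁺/⟨Y_i^{k_i}, R̃_J, D̃_K, S̃_{H,L}⟩` as a non-unital `𝔽₂`-algebra. -/
def Qplus (r : ℕ) (k : Fin r → ℕ)
    (btilM : Finset (Fin r) → MvPolynomial (Fin r) (ZMod 2)) : Ideal (QRing r k btilM) :=
  Ideal.map (Ideal.Quotient.mk (relIdeal r k btilM)) (Pplus r)

/-- The evaluation `P → C`, `Y_i ↦ y_i`, `c_I ↦ C_I`. -/
def phiP (r : ℕ) (k : Fin r → ℕ) (btil : Fin r → MvPolynomial (Fin r) (ZMod 2)) :
    PRing r →ₐ[ZMod 2] KRing r k btil :=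
  aeval (Sum.elim (ky r k btil) fun I : {I : Finset (Fin r) // 2 ≤ I.card} => kC r k btil I.1)

/-- The indices at which the multidegree `d` lies strictly between `0` and `k`. -/
def freeIndices {r : ℕ} (k d : Fin r → ℕ) : Finset (Fin r) :=
  Finset.univ.filter fun i => 0 < d i ∧ d i < k i

/-- The least index at which `d` lies strictly between `0` and `k`, if there is one. -/
def pivot {r : ℕ} (k d : Fin r → ℕ) : Option (Fin r) :=
  if h : (freeIndices k d).Nonempty then some ((freeIndices k d).min' h) else none

lemma pivot_eq_some {r : ℕ} {k d : Fin r → ℕ} {m : Fin r} (h : pivot k d = some m) :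
    0 < d m ∧ d m < k m := by
  unfold pivot at h
  split_ifs at h with hne
  have hm := (freeIndices k d).min'_mem hne
  rw [Option.some.inj h] at hm
  simpa [freeIndices] using hm

lemma pivot_eq_none {r : ℕ} {k d : Fin r → ℕ} (h : pivot k d = none) (i : Fin r)
    (hi : 0 < d i) : k i ≤ d i := by
  unfold pivot at h
  split_ifs at h with hne
  by_contra! hlt
  exact hne ⟨i, by simp [freeIndices, hi, hlt]⟩

/-- The multidegree of `y^a θ_J`. -/
def multidegree {r : ℕ} (J : Finset (Fin r)) (a : Fin r →₀ ℕ) : Fin r → ℕ :=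
  fun i => a i + if i ∈ J then 1 else 0

lemma multidegree_erase {r : ℕ} {I : Finset (Fin r)} {i : Fin r} (hi : i ∈ I)
    (a : Fin r →₀ ℕ) :
    multidegree (I.erase i) (a + Finsupp.single i 1) = multidegree I a := by
  funext j
  by_cases hj : j = i
  · subst hj
    simp [multidegree, hi]
  · simp [multidegree, hj]

/-- The monomial `y^a`. -/
def yMonomial {r : ℕ} {S : Type*} [CommRing S] (y : Fin r → S) (a : Fin r →₀ ℕ) : S :=
  ∏ i, y i ^ a i

lemma yMonomial_add {r : ℕ} {S : Type*} [CommRing S] (y : Fin r → S) (a b : Fin r →₀ ℕ) :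
    yMonomial y (a + b) = yMonomial y a * yMonomial y b := by
  simp [yMonomial, pow_add, Finset.prod_mul_distrib]

lemma yMonomial_single {r : ℕ} {S : Type*} [CommRing S] (y : Fin r → S) (i : Fin r) (n : ℕ) :
    yMonomial y (Finsupp.single i n) = y i ^ n := by
  rw [yMonomial, Finset.prod_eq_single i]
  · simp
  · intro j _ hj
    simp [Ne.symm hj]
  · simp

lemma yMonomial_eq_zero {r : ℕ} {S : Type*} [CommRing S] {k : Fin r → ℕ} {y : Fin r → S}
    (hy : ∀ i, y i ^ k i = 0) {a : Fin r →₀ ℕ} {i : Fin r} (hi : k i ≤ a i) :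
    yMonomial y a = 0 :=
  Finset.prod_eq_zero (Finset.mem_univ i) (pow_eq_zero_of_le hi (hy i))

/-- The value at `y^a θ_J` of the contracting homotopy of the Koszul complex, followed by
`y^a θ_I ↦ y^a c_I`. -/
def homotopyValue {r : ℕ} {S : Type*} [CommRing S] (k : Fin r → ℕ) (y : Fin r → S)
    (c : Finset (Fin r) → S) (J : Finset (Fin r)) (a : Fin r →₀ ℕ) : S :=
  match pivot k (multidegree J a) with
  | none => 0
  | some m => if m ∈ J then 0 else yMonomial y (a - Finsupp.single m 1) * c (insert m J)

lemma homotopyValue_eq_zero {r : ℕ} {S : Type*} [CommRing S] {k : Fin r → ℕ} {y : Fin r → S}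
    (hy : ∀ i, y i ^ k i = 0) (c : Finset (Fin r) → S) (J : Finset (Fin r)) {a : Fin r →₀ ℕ}
    {i : Fin r} (hi : k i ≤ a i) : homotopyValue k y c J a = 0 := by
  unfold homotopyValue
  split
  · rfl
  · rename_i m hm
    have hlt := (pivot_eq_some hm).2
    have hmi : m ≠ i := by
      rintro rfl
      simp only [multidegree] at hlt
      omega
    split_ifs
    · rfl
    · rw [yMonomial_eq_zero hy (i := i), zero_mul]
      simpa [Finsupp.single_apply, hmi] using hi

/-- The contracting homotopy inverts the Koszul differential on boundaries. -/
lemma sum_homotopyValue {r : ℕ} {S : Type*} [CommRing S] {k : Fin r → ℕ} {y : Fin r → S}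
    {c : Finset (Fin r) → S} (h2 : ∀ x : S, x + x = 0)
    (hR : ∀ J : Finset (Fin r), (∏ j ∈ J, y j ^ (k j - 1)) * c J = 0)
    (hD : ∀ K : Finset (Fin r), ∑ i ∈ K, y i * c (K.erase i) = 0)
    (I : Finset (Fin r)) (a : Fin r →₀ ℕ) :
    ∑ i ∈ I, homotopyValue k y c (I.erase i) (a + Finsupp.single i 1) =
      yMonomial y a * c I := by
  cases hp : pivot k (multidegree I a) with
  | none =>
    rw [Finset.sum_eq_zero fun i hi => by
      simp only [homotopyValue, multidegree_erase hi, hp]]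
    have hdvd : (∏ j ∈ I, y j ^ (k j - 1)) ∣ yMonomial y a := by
      refine (Finset.prod_dvd_prod_of_dvd _ _ fun j hj => pow_dvd_pow _ ?_).trans
        (Finset.prod_dvd_prod_of_subset I _ _ (Finset.subset_univ I))
      have := pivot_eq_none hp j (by simp [multidegree, hj])
      simp only [multidegree, hj, if_true] at this
      omega
    obtain ⟨z, hz⟩ := hdvd
    rw [hz, mul_right_comm, hR, zero_mul]
  | some m =>
    have hterm : ∀ i ∈ I, homotopyValue k y c (I.erase i) (a + Finsupp.single i 1) =
        if m ∈ I.erase i then 0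
        else yMonomial y (a + Finsupp.single i 1 - Finsupp.single m 1) *
          c (insert m (I.erase i)) := by
      intro i hi
      simp only [homotopyValue, multidegree_erase hi, hp]
    rw [Finset.sum_congr rfl hterm]
    by_cases hm : m ∈ I
    · rw [Finset.sum_eq_single_of_mem m hm]
      · simp [Finset.insert_erase hm]
      · intro i _ him
        simp [hm, Ne.symm him]
    · have ha : Finsupp.single m 1 ≤ a := by
        have := (pivot_eq_some hp).1
        simp only [multidegree, hm, if_false] at this
        simpa [Nat.one_le_iff_ne_zero] using (by omega : a m ≠ 0)
      obtain ⟨a', rfl⟩ := exists_add_of_le ha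
      have hD' := hD (insert m I)
      rw [Finset.sum_insert hm, Finset.erase_insert hm] at hD'
      have hsum : ∑ i ∈ I, y i * c ((insert m I).erase i) = y m * c I := by
        rw [eq_comm, ← sub_eq_zero, ← hD', sub_eq_add_neg, add_right_inj, neg_eq_iff_add_eq_zero]
        exact h2 _
      rw [yMonomial_add, yMonomial_single, pow_one, mul_assoc, mul_left_comm, ← hsum,
        Finset.mul_sum]
      refine Finset.sum_congr rfl fun i hi => ?_
      have him : m ≠ i := fun h => hm (h ▸ hi)
      rw [if_neg fun h => hm (Finset.mem_of_mem_erase h), add_assoc, add_tsub_cancel_left,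
        yMonomial_add, yMonomial_single, pow_one, Finset.erase_insert_of_ne him, mul_assoc]

/-- The coordinates of a polynomial in the `θ_i` in the basis `θ_I`, after reduction by
`θ_i² = b_i`. -/
def thetaCoords {r : ℕ} (btil : Fin r → MvPolynomial (Fin r) (ZMod 2)) :
    MvPolynomial (Fin r) (MvPolynomial (Fin r) (ZMod 2)) →ₗ[MvPolynomial (Fin r) (ZMod 2)]
      (Finset (Fin r) →₀ MvPolynomial (Fin r) (ZMod 2)) :=
  (basisMonomials (Fin r) (MvPolynomial (Fin r) (ZMod 2))).constr
    (MvPolynomial (Fin r) (ZMod 2)) fun e =>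
      Finsupp.single (Finset.univ.filter fun i => Odd (e i)) (∏ i, btil i ^ (e i / 2))

lemma thetaCoords_monomial {r : ℕ} (btil : Fin r → MvPolynomial (Fin r) (ZMod 2))
    (e : Fin r →₀ ℕ) (q : MvPolynomial (Fin r) (ZMod 2)) :
    thetaCoords btil (monomial e q) =
      q • Finsupp.single (Finset.univ.filter fun i => Odd (e i)) (∏ i, btil i ^ (e i / 2)) := by
  have h : (monomial e q : MvPolynomial (Fin r) (MvPolynomial (Fin r) (ZMod 2))) =
      q • basisMonomials (Fin r) (MvPolynomial (Fin r) (ZMod 2)) e := by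
    simp [smul_monomial]
  rw [h, map_smul, thetaCoords, Module.Basis.constr_basis]

lemma thetaCoords_mul_sq_sub {r : ℕ} (btil : Fin r → MvPolynomial (Fin r) (ZMod 2)) (i : Fin r)
    (f : MvPolynomial (Fin r) (MvPolynomial (Fin r) (ZMod 2))) :
    thetaCoords btil (f * (X i ^ 2 - C (btil i))) = 0 := by
  induction f using MvPolynomial.induction_on' with
  | add p q hp hq => rw [add_mul, map_add, hp, hq, add_zero]
  | monomial e q =>
    have hX : (monomial e q * X i ^ 2 : MvPolynomial (Fin r) (MvPolynomial (Fin r) (ZMod 2))) =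
        monomial (e + Finsupp.single i 2) q := by
      rw [X_pow_eq_monomial, monomial_mul, mul_one]
    have hC : (monomial e q * C (btil i) :
        MvPolynomial (Fin r) (MvPolynomial (Fin r) (ZMod 2))) = monomial e (q * btil i) := by
      rw [mul_comm, C_mul_monomial, mul_comm]
    have hodd : (Finset.univ.filter fun j => Odd ((e + Finsupp.single i 2 : Fin r →₀ ℕ) j)) =
        Finset.univ.filter fun j => Odd (e j) := by
      refine Finset.filter_congr fun j _ => ?_
      by_cases hj : j = i
      · subst hj
        simp [Nat.odd_add]
      · simp [hj]
    have hprod : ∏ j, btil j ^ ((e + Finsupp.single i 2 : Fin r →₀ ℕ) j / 2) =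
        btil i * ∏ j, btil j ^ (e j / 2) := by
      rw [← Finset.mul_prod_erase _ _ (Finset.mem_univ i),
        ← Finset.mul_prod_erase _ (fun j => btil j ^ (e j / 2)) (Finset.mem_univ i), ← mul_assoc]
      congr 1
      · simp [pow_succ']
      · refine Finset.prod_congr rfl fun j hj => ?_
        simp [Finset.ne_of_mem_erase hj]
    rw [mul_sub, map_sub, hX, hC, thetaCoords_monomial, thetaCoords_monomial, hodd, hprod,
      sub_eq_zero, Finsupp.smul_single, Finsupp.smul_single, smul_eq_mul, smul_eq_mul, mul_assoc]

lemma thetaCoords_prod {r : ℕ} (btil : Fin r → MvPolynomial (Fin r) (ZMod 2))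
    (q : MvPolynomial (Fin r) (ZMod 2)) (I : Finset (Fin r)) :
    thetaCoords btil (C q * ∏ i ∈ I, X i) = Finsupp.single I q := by
  have hprod : (C q * ∏ i ∈ I, X i : MvPolynomial (Fin r) (MvPolynomial (Fin r) (ZMod 2))) =
      monomial (∑ i ∈ I, Finsupp.single i 1) q := by
    rw [← mul_one q, ← C_mul_monomial, monomial_sum_one]
    simp [X]
  have he : ∀ j, (∑ i ∈ I, Finsupp.single i 1 : Fin r →₀ ℕ) j = if j ∈ I then 1 else 0 := by
    intro j
    simp [Finsupp.finsetSum_apply, Finsupp.single_apply]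
  rw [hprod, thetaCoords_monomial]
  have hodd : (Finset.univ.filter fun j => Odd ((∑ i ∈ I, Finsupp.single i 1 : Fin r →₀ ℕ) j)) =
      I := by
    ext j
    by_cases hj : j ∈ I <;> simp [he, hj]
  rw [hodd, Finset.prod_eq_one, Finsupp.smul_single, smul_eq_mul, mul_one]
  intro j _
  rw [he]
  split_ifs <;> simp

/-- The linear extension of `homotopyValue` in the exponent of `y`. -/
def homotopyLin {r : ℕ} {S : Type*} [CommRing S] [Algebra (ZMod 2) S] (k : Fin r → ℕ)
    (y : Fin r → S) (c : Finset (Fin r) → S) (J : Finset (Fin r)) :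
    MvPolynomial (Fin r) (ZMod 2) →ₗ[ZMod 2] S :=
  (basisMonomials (Fin r) (ZMod 2)).constr (ZMod 2) (homotopyValue k y c J)

lemma homotopyLin_monomial {r : ℕ} {S : Type*} [CommRing S] [Algebra (ZMod 2) S]
    (k : Fin r → ℕ) (y : Fin r → S) (c : Finset (Fin r) → S) (J : Finset (Fin r))
    (a : Fin r →₀ ℕ) (t : ZMod 2) :
    homotopyLin k y c J (monomial a t) = t • homotopyValue k y c J a := by
  have h : (monomial a t : MvPolynomial (Fin r) (ZMod 2)) =
      t • basisMonomials (Fin r) (ZMod 2) a := by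
    simp [smul_monomial]
  rw [h, map_smul, homotopyLin, Module.Basis.constr_basis]

lemma homotopyLin_X_pow_mul {r : ℕ} {S : Type*} [CommRing S] [Algebra (ZMod 2) S]
    {k : Fin r → ℕ} {y : Fin r → S} (hy : ∀ i, y i ^ k i = 0) (c : Finset (Fin r) → S)
    (J : Finset (Fin r)) (i : Fin r) (q : MvPolynomial (Fin r) (ZMod 2)) :
    homotopyLin k y c J (X i ^ k i * q) = 0 := by
  induction q using MvPolynomial.induction_on' with
  | add p q hp hq => rw [mul_add, map_add, hp, hq, add_zero]
  | monomial a t =>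
    rw [X_pow_eq_monomial, monomial_mul, homotopyLin_monomial,
      homotopyValue_eq_zero hy c J (i := i) (by simp), smul_zero]

lemma sum_homotopyLin {r : ℕ} {S : Type*} [CommRing S] [Algebra (ZMod 2) S]
    {k : Fin r → ℕ} {y : Fin r → S} {c : Finset (Fin r) → S}
    (hR : ∀ J : Finset (Fin r), (∏ j ∈ J, y j ^ (k j - 1)) * c J = 0)
    (hD : ∀ K : Finset (Fin r), ∑ i ∈ K, y i * c (K.erase i) = 0)
    (I : Finset (Fin r)) (q : MvPolynomial (Fin r) (ZMod 2)) :
    ∑ i ∈ I, homotopyLin k y c (I.erase i) (q * X i) = aeval y q * c I := by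
  induction q using MvPolynomial.induction_on' with
  | add p q hp hq => simp only [add_mul, map_add, Finset.sum_add_distrib, hp, hq]
  | monomial a t =>
    have h2 : ∀ x : S, x + x = 0 := ZModModule.add_self
    simp only [X, monomial_mul, mul_one, homotopyLin_monomial]
    rw [← Finset.smul_sum, sum_homotopyValue h2 hR hD, aeval_monomial, Algebra.smul_def,
      mul_assoc, yMonomial, Finsupp.prod_fintype _ _ fun i => pow_zero _]

/-- The map `homotopyLin` assembled over all `θ_J`, on polynomials in the `y_i` and `θ_i`. -/
def koszulHomotopy {r : ℕ} {S : Type*} [CommRing S] [Algebra (ZMod 2) S] (k : Fin r → ℕ)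
    (btil : Fin r → MvPolynomial (Fin r) (ZMod 2)) (y : Fin r → S) (c : Finset (Fin r) → S) :
    MvPolynomial (Fin r ⊕ Fin r) (ZMod 2) →ₗ[ZMod 2] S :=
  (Finsupp.lsum (ZMod 2) (homotopyLin k y c)) ∘ₗ
    (thetaCoords btil).restrictScalars (ZMod 2) ∘ₗ
      (aeval (Sum.elim (fun i => C (X i)) X) : MvPolynomial (Fin r ⊕ Fin r) (ZMod 2) →ₐ[ZMod 2]
        MvPolynomial (Fin r) (MvPolynomial (Fin r) (ZMod 2))).toLinearMap

lemma aeval_sumElim_rename_inl {r : ℕ} (q : MvPolynomial (Fin r) (ZMod 2)) :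
    (aeval (Sum.elim (fun i => C (X i)) X) (rename Sum.inl q : MvPolynomial (Fin r ⊕ Fin r) _) :
        MvPolynomial (Fin r) (MvPolynomial (Fin r) (ZMod 2))) = C q := by
  rw [aeval_rename]
  induction q using MvPolynomial.induction_on with
  | C t => simp [algebraMap_eq, MvPolynomial.algebraMap_apply]
  | add p q hp hq => rw [map_add, map_add, hp, hq]
  | mul_X p i hp => rw [map_mul, map_mul, hp, aeval_X]; rfl

lemma koszulHomotopy_rename_mul_prod {r : ℕ} {S : Type*} [CommRing S] [Algebra (ZMod 2) S]
    (k : Fin r → ℕ) (btil : Fin r → MvPolynomial (Fin r) (ZMod 2)) (y : Fin r → S)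
    (c : Finset (Fin r) → S) (q : MvPolynomial (Fin r) (ZMod 2)) (I : Finset (Fin r)) :
    koszulHomotopy k btil y c (rename Sum.inl q * ∏ i ∈ I, X (Sum.inr i)) =
      homotopyLin k y c I q := by
  simp only [koszulHomotopy, LinearMap.comp_apply, AlgHom.toLinearMap_apply, map_mul, map_prod,
    aeval_sumElim_rename_inl, aeval_X, Sum.elim_inr, LinearMap.restrictScalars_apply,
    thetaCoords_prod, Finsupp.lsum_single]

lemma koszulHomotopy_mul_X_pow {r : ℕ} {S : Type*} [CommRing S] [Algebra (ZMod 2) S]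
    {k : Fin r → ℕ} (btil : Fin r → MvPolynomial (Fin r) (ZMod 2)) {y : Fin r → S}
    (hy : ∀ i, y i ^ k i = 0) (c : Finset (Fin r) → S)
    (p : MvPolynomial (Fin r ⊕ Fin r) (ZMod 2)) (i : Fin r) :
    koszulHomotopy k btil y c (p * X (Sum.inl i) ^ k i) = 0 := by
  simp only [koszulHomotopy, LinearMap.comp_apply, AlgHom.toLinearMap_apply, map_mul, map_pow,
    aeval_X, Sum.elim_inl, LinearMap.restrictScalars_apply]
  rw [mul_comm, ← C_pow, C_mul', map_smul]
  generalize thetaCoords btil _ = v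
  induction v using Finsupp.induction_linear with
  | zero => simp
  | add v w hv hw => rw [smul_add, map_add, hv, hw, add_zero]
  | single J q =>
    rw [Finsupp.smul_single, Finsupp.lsum_single, smul_eq_mul, homotopyLin_X_pow_mul hy]

lemma koszulHomotopy_mul_sq_sub {r : ℕ} {S : Type*} [CommRing S] [Algebra (ZMod 2) S]
    (k : Fin r → ℕ) (btil : Fin r → MvPolynomial (Fin r) (ZMod 2)) (y : Fin r → S)
    (c : Finset (Fin r) → S) (p : MvPolynomial (Fin r ⊕ Fin r) (ZMod 2)) (i : Fin r) :
    koszulHomotopy k btil y c (p * (X (Sum.inr i) ^ 2 - rename Sum.inl (btil i))) = 0 := by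
  simp only [koszulHomotopy, LinearMap.comp_apply, AlgHom.toLinearMap_apply, map_mul, map_sub,
    map_pow, aeval_sumElim_rename_inl, aeval_X, Sum.elim_inr, LinearMap.restrictScalars_apply,
    thetaCoords_mul_sq_sub, map_zero]

lemma kC_eq {r : ℕ} (k : Fin r → ℕ) (btil : Fin r → MvPolynomial (Fin r) (ZMod 2))
    (I : Finset (Fin r)) :
    kC r k btil I = ∑ i ∈ I, ky r k btil i * kTheta r k btil (I.erase i) := by
  have h : (-1 : KRing r k btil) = 1 := ZModModule.neg_eq_self 1
  simp only [kC, h, one_pow, one_mul]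

lemma exists_linearMap_ideal_quotient {K R S : Type*} [CommRing K] [CommRing R] [Algebra K R]
    [AddCommGroup S] [Module K S] (I : Ideal R) (f : R →ₗ[K] S) (hf : ∀ x ∈ I, f x = 0) :
    ∃ G : (R ⧸ I) →ₗ[K] S, ∀ x, G (Ideal.Quotient.mk I x) = f x :=
  ⟨((I.restrictScalars K).liftQ f hf) ∘ₗ
    (Submodule.Quotient.restrictScalarsEquiv K I).symm.toLinearMap, fun _ => rfl⟩

/-- Elements `y_i`, `c_I` of an `𝔽₂`-algebra satisfying the linear relations of the `C_I`
determine a linear map on `C` sending `q C_I` to `q c_I`. -/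
lemma exists_linearMap_kC {r : ℕ} {S : Type*} [CommRing S] [Algebra (ZMod 2) S]
    {k : Fin r → ℕ} (btil : Fin r → MvPolynomial (Fin r) (ZMod 2)) {y : Fin r → S}
    {c : Finset (Fin r) → S} (hy : ∀ i, y i ^ k i = 0)
    (hR : ∀ J : Finset (Fin r), (∏ j ∈ J, y j ^ (k j - 1)) * c J = 0)
    (hD : ∀ K : Finset (Fin r), ∑ i ∈ K, y i * c (K.erase i) = 0) :
    ∃ G : KRing r k btil →ₗ[ZMod 2] S,
      ∀ (q : MvPolynomial (Fin r) (ZMod 2)) (I : Finset (Fin r)),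
        G (yEval r k btil q * kC r k btil I) = aeval y q * c I := by
  have hker : ∀ x ∈ Ideal.span
      ((Set.range fun i : Fin r =>
          (X (Sum.inl i) : MvPolynomial (Fin r ⊕ Fin r) (ZMod 2)) ^ k i) ∪
       (Set.range fun i : Fin r =>
          (X (Sum.inr i) : MvPolynomial (Fin r ⊕ Fin r) (ZMod 2)) ^ 2
            - rename Sum.inl (btil i))),
      ∀ p, koszulHomotopy k btil y c (p * x) = 0 := by
    intro x hx
    induction hx using Submodule.span_induction with
    | mem x hx =>
      rintro p
      rcases hx with ⟨i, rfl⟩ | ⟨i, rfl⟩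
      · exact koszulHomotopy_mul_X_pow btil hy c p i
      · exact koszulHomotopy_mul_sq_sub k btil y c p i
    | zero => simp
    | add a b _ _ ha hb => intro p; rw [mul_add, map_add, ha, hb, add_zero]
    | smul s a _ ha => intro p; rw [smul_eq_mul, ← mul_assoc, ha]
  obtain ⟨G, hG⟩ := exists_linearMap_ideal_quotient _ (koszulHomotopy k btil y c)
    fun x hx => by simpa using hker x hx 1
  refine ⟨G, fun q I => ?_⟩
  have hq : yEval r k btil q * kC r k btil I = Ideal.Quotient.mk _
      (∑ i ∈ I, rename Sum.inl (q * X i) * ∏ j ∈ I.erase i, X (Sum.inr j)) := by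
    simp only [kC_eq, yEval, ky, kTheta, kth, map_sum, map_mul, map_prod, Finset.mul_sum,
      mul_assoc, rename_X]
  rw [hq, hG, map_sum, ← sum_homotopyLin hR hD]
  exact Finset.sum_congr rfl fun i _ => koszulHomotopy_rename_mul_prod k btil y c _ _

/-- The Koszul differential on polynomials in the `y_i` and `θ_i`. -/
def koszulDerivation (r : ℕ) : Derivation (ZMod 2) (MvPolynomial (Fin r ⊕ Fin r) (ZMod 2))
    (MvPolynomial (Fin r ⊕ Fin r) (ZMod 2)) :=
  mkDerivation (ZMod 2) (Sum.elim 0 fun i => X (Sum.inl i))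

lemma koszulDerivation_X_inl {r : ℕ} (i : Fin r) : koszulDerivation r (X (Sum.inl i)) = 0 := by
  simp [koszulDerivation, mkDerivation_X]

lemma koszulDerivation_X_inr {r : ℕ} (i : Fin r) :
    koszulDerivation r (X (Sum.inr i)) = X (Sum.inl i) := by
  simp [koszulDerivation, mkDerivation_X]

lemma koszulDerivation_rename_inl {r : ℕ} (q : MvPolynomial (Fin r) (ZMod 2)) :
    koszulDerivation r (rename Sum.inl q) = 0 := by
  induction q using MvPolynomial.induction_on with
  | C t => rw [rename_C, ← algebraMap_eq, Derivation.map_algebraMap]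
  | add p q hp hq => rw [map_add, map_add, hp, hq, add_zero]
  | mul_X p i hp =>
    rw [map_mul, rename_X, Derivation.leibniz, hp, koszulDerivation_X_inl, smul_zero, smul_zero,
      add_zero]

lemma koszulDerivation_koszulDerivation {r : ℕ} (p : MvPolynomial (Fin r ⊕ Fin r) (ZMod 2)) :
    koszulDerivation r (koszulDerivation r p) = 0 := by
  induction p using MvPolynomial.induction_on with
  | C t => rw [← algebraMap_eq, Derivation.map_algebraMap, map_zero]
  | add p q hp hq => rw [map_add, map_add, hp, hq, add_zero]
  | mul_X p v hp =>
    have hv : koszulDerivation r (koszulDerivation r (X v)) = 0 := by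
      rcases v with i | i
      · rw [koszulDerivation_X_inl, map_zero]
      · rw [koszulDerivation_X_inr, koszulDerivation_X_inl]
    rw [Derivation.leibniz, map_add, smul_eq_mul, smul_eq_mul, Derivation.leibniz,
      Derivation.leibniz, hp, hv, smul_zero, smul_zero, zero_add, zero_add, smul_eq_mul,
      smul_eq_mul, mul_comm]
    exact ZModModule.add_self _

lemma koszulDerivation_prod {r : ℕ} (I : Finset (Fin r)) :
    koszulDerivation r (∏ i ∈ I, X (Sum.inr i)) =
      ∑ i ∈ I, X (Sum.inl i) * ∏ j ∈ I.erase i, X (Sum.inr j) := by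
  induction I using Finset.induction_on with
  | empty => simp
  | insert a I ha ih =>
    rw [Finset.prod_insert ha, Derivation.leibniz, ih, koszulDerivation_X_inr,
      Finset.sum_insert ha, Finset.erase_insert ha, smul_eq_mul, smul_eq_mul, add_comm,
      mul_comm, Finset.mul_sum]
    congr 1
    refine Finset.sum_congr rfl fun i hi => ?_
    have hai : a ≠ i := fun h => ha (h ▸ hi)
    rw [Finset.erase_insert_of_ne hai, Finset.prod_insert fun h => ha (Finset.mem_of_mem_erase h),
      mul_left_comm]

/-- The Koszul differential preserves the ideal defining `C`. -/
lemma mk_koszulDerivation_eq_zero {r : ℕ} (k : Fin r → ℕ)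
    (btil : Fin r → MvPolynomial (Fin r) (ZMod 2))
    {p : MvPolynomial (Fin r ⊕ Fin r) (ZMod 2)}
    (hp : (Ideal.Quotient.mk _ p : KRing r k btil) = 0) :
    (Ideal.Quotient.mk _ (koszulDerivation r p) : KRing r k btil) = 0 := by
  rw [Ideal.Quotient.eq_zero_iff_mem] at hp ⊢
  induction hp using Submodule.span_induction with
  | mem x hx =>
    rcases hx with ⟨i, rfl⟩ | ⟨i, rfl⟩
    · dsimp only
      rw [Derivation.leibniz_pow, koszulDerivation_X_inl, smul_zero, smul_zero]
      exact zero_mem _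
    · dsimp only
      rw [map_sub, Derivation.leibniz_pow, koszulDerivation_rename_inl, sub_zero, two_nsmul]
      exact (ZModModule.add_self (_ : MvPolynomial (Fin r ⊕ Fin r) (ZMod 2))) ▸ zero_mem _
  | zero => rw [map_zero]; exact zero_mem _
  | add a b _ _ ha hb => rw [map_add]; exact add_mem ha hb
  | smul s a has ha =>
    rw [smul_eq_mul, Derivation.leibniz, smul_eq_mul, smul_eq_mul]
    exact add_mem (Ideal.mul_mem_left _ _ ha) (Ideal.mul_mem_right _ _ has)

lemma mk_koszulDerivation_congr {r : ℕ} (k : Fin r → ℕ)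
    (btil : Fin r → MvPolynomial (Fin r) (ZMod 2))
    {p q : MvPolynomial (Fin r ⊕ Fin r) (ZMod 2)}
    (h : (Ideal.Quotient.mk _ p : KRing r k btil) = Ideal.Quotient.mk _ q) :
    (Ideal.Quotient.mk _ (koszulDerivation r p) : KRing r k btil) =
      Ideal.Quotient.mk _ (koszulDerivation r q) := by
  rw [← sub_eq_zero, ← map_sub] at h
  rw [← sub_eq_zero, ← map_sub, ← map_sub]
  exact mk_koszulDerivation_eq_zero k btil h

lemma mk_koszulDerivation_prod {r : ℕ} (k : Fin r → ℕ)
    (btil : Fin r → MvPolynomial (Fin r) (ZMod 2)) (I : Finset (Fin r)) :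
    (Ideal.Quotient.mk _ (koszulDerivation r (∏ i ∈ I, X (Sum.inr i))) : KRing r k btil) =
      kC r k btil I := by
  simp only [koszulDerivation_prod, kC_eq, ky, kTheta, kth, map_sum, map_mul, map_prod]

lemma ky_pow {r : ℕ} (k : Fin r → ℕ) (btil : Fin r → MvPolynomial (Fin r) (ZMod 2))
    (i : Fin r) : ky r k btil i ^ k i = 0 := by
  rw [ky, ← map_pow, Ideal.Quotient.eq_zero_iff_mem]
  exact Ideal.subset_span (Or.inl ⟨i, rfl⟩)

lemma kth_sq {r : ℕ} (k : Fin r → ℕ) (btil : Fin r → MvPolynomial (Fin r) (ZMod 2))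
    (i : Fin r) : kth r k btil i ^ 2 = kb r k btil i := by
  rw [kth, kb, yEval, ← map_pow, Ideal.Quotient.eq]
  exact Ideal.subset_span (Or.inr ⟨i, rfl⟩)

lemma prod_mul_prod_symmDiff {ι R : Type*} [DecidableEq ι] [CommRing R] (f : ι → R)
    (S T : Finset ι) :
    (∏ i ∈ S, f i) * ∏ i ∈ T, f i = (∏ i ∈ S ∩ T, f i ^ 2) * ∏ i ∈ symmDiff S T, f i := by
  have hdisj : Disjoint (S \ T) (T \ S) := disjoint_sdiff_sdiff
  rw [symmDiff_def, Finset.sup_eq_union, Finset.prod_union hdisj,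
    ← Finset.prod_inter_mul_prod_sdiff S T f, ← Finset.prod_inter_mul_prod_sdiff T S f,
    Finset.inter_comm T S, Finset.prod_pow]
  ring

lemma kTheta_mul_kTheta {r : ℕ} (k : Fin r → ℕ) (btil : Fin r → MvPolynomial (Fin r) (ZMod 2))
    (S T : Finset (Fin r)) :
    kTheta r k btil S * kTheta r k btil T =
      kbM r k btil (S ∩ T) * kTheta r k btil (symmDiff S T) := by
  simp only [kTheta, kbM, prod_mul_prod_symmDiff, kth_sq]

lemma sum_ky_mul_kC_erase {r : ℕ} (k : Fin r → ℕ)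
    (btil : Fin r → MvPolynomial (Fin r) (ZMod 2)) (K : Finset (Fin r)) :
    ∑ i ∈ K, ky r k btil i * kC r k btil (K.erase i) = 0 := by
  have h : koszulDerivation r (koszulDerivation r (∏ i ∈ K, X (Sum.inr i))) =
      ∑ i ∈ K, X (Sum.inl i) * koszulDerivation r (∏ j ∈ K.erase i, X (Sum.inr j)) := by
    rw [koszulDerivation_prod, map_sum]
    refine Finset.sum_congr rfl fun i _ => ?_
    rw [Derivation.leibniz, koszulDerivation_X_inl, smul_zero, add_zero, smul_eq_mul]
  rw [koszulDerivation_koszulDerivation] at h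
  have h' := congrArg (Ideal.Quotient.mk _ : _ →+* KRing r k btil) h
  rw [map_zero, map_sum] at h'
  simp only [map_mul, mk_koszulDerivation_prod] at h'
  exact h'.symm

lemma kC_mul_kC {r : ℕ} (k : Fin r → ℕ) (btil : Fin r → MvPolynomial (Fin r) (ZMod 2))
    (H L : Finset (Fin r)) :
    kC r k btil H * kC r k btil L = ∑ i ∈ H, ky r k btil i *
      kbM r k btil (H.erase i ∩ L) * kC r k btil (symmDiff (H.erase i) L) := by
  have hθ : (Ideal.Quotient.mk _ (koszulDerivation r (∏ i ∈ H, X (Sum.inr i)) *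
        ∏ i ∈ L, X (Sum.inr i)) : KRing r k btil) =
      Ideal.Quotient.mk _ (∑ i ∈ H, rename Sum.inl (X i * ∏ j ∈ H.erase i ∩ L, btil j) *
        ∏ j ∈ symmDiff (H.erase i) L, X (Sum.inr j)) := by
    have h := fun i => kTheta_mul_kTheta k btil (H.erase i) L
    simp only [kTheta, kbM, kth, kb, yEval] at h
    simp only [koszulDerivation_prod, map_mul, map_sum, map_prod, rename_X, Finset.sum_mul,
      mul_assoc, h]
  have hδ := mk_koszulDerivation_congr k btil hθ
  rw [Derivation.leibniz, koszulDerivation_koszulDerivation, smul_zero, add_zero, smul_eq_mul,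
    map_mul, mk_koszulDerivation_prod, mk_koszulDerivation_prod] at hδ
  rw [hδ, map_sum, map_sum]
  refine Finset.sum_congr rfl fun i _ => ?_
  rw [Derivation.leibniz, koszulDerivation_rename_inl, smul_zero, add_zero, smul_eq_mul, map_mul,
    mk_koszulDerivation_prod]
  simp only [map_mul, map_prod, rename_X, ky, kbM, kb, yEval]

lemma prod_ky_pow_mul_kC {r : ℕ} {k : Fin r → ℕ} (hk : ∀ i, 1 ≤ k i)
    (btil : Fin r → MvPolynomial (Fin r) (ZMod 2)) (J : Finset (Fin r)) :
    (∏ j ∈ J, ky r k btil j ^ (k j - 1)) * kC r k btil J = 0 := by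
  rw [kC_eq, Finset.mul_sum]
  refine Finset.sum_eq_zero fun i hi => ?_
  have h : ky r k btil i ^ (k i - 1) * ky r k btil i = 0 := by
    rw [← pow_succ, Nat.sub_add_cancel (hk i), ky_pow]
  rw [← Finset.mul_prod_erase _ _ hi, mul_mul_mul_comm, h, zero_mul]

lemma cP_empty (r : ℕ) : cP r ∅ = 0 := by
  simp [cP]

lemma cP_singleton {r : ℕ} (t : Fin r) : cP r {t} = X (Sum.inl t) := by
  simp [cP]

lemma cP_of_two_le {r : ℕ} {I : Finset (Fin r)} (h : 2 ≤ I.card) :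
    cP r I = X (Sum.inr ⟨I, h⟩) := by
  simp [cP, h]

lemma eq_empty_or_singleton_or_two_le_card {α : Type*} (I : Finset α) :
    I = ∅ ∨ (∃ t, I = {t}) ∨ 2 ≤ I.card := by
  rcases Nat.lt_or_ge I.card 2 with h | h
  · interval_cases hI : I.card
    · exact Or.inl (Finset.card_eq_zero.mp hI)
    · exact Or.inr (Or.inl (Finset.card_eq_one.mp hI))
  · exact Or.inr (Or.inr h)

lemma cP_mem_Pplus {r : ℕ} (I : Finset (Fin r)) : cP r I ∈ Pplus r := by
  rw [Pplus, RingHom.mem_ker]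
  rcases eq_empty_or_singleton_or_two_le_card I with rfl | ⟨t, rfl⟩ | h
  · rw [cP_empty, map_zero]
  · rw [cP_singleton, constantCoeff_X]
  · rw [cP_of_two_le h, constantCoeff_X]

lemma phiP_rename {r : ℕ} (k : Fin r → ℕ) (btil : Fin r → MvPolynomial (Fin r) (ZMod 2))
    (q : MvPolynomial (Fin r) (ZMod 2)) :
    phiP r k btil (rename Sum.inl q) = yEval r k btil q := by
  have h : (phiP r k btil).comp (rename Sum.inl) =
      (Ideal.Quotient.mkₐ (ZMod 2) _ :
        MvPolynomial (Fin r ⊕ Fin r) (ZMod 2) →ₐ[ZMod 2] KRing r k btil).comp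
          (rename Sum.inl) := by
    ext i
    simp [phiP, ky]
  exact DFunLike.congr_fun h q

lemma phiP_X_inl {r : ℕ} (k : Fin r → ℕ) (btil : Fin r → MvPolynomial (Fin r) (ZMod 2))
    (i : Fin r) : phiP r k btil (X (Sum.inl i)) = ky r k btil i := by
  rw [phiP, aeval_X, Sum.elim_inl]

lemma phiP_cP {r : ℕ} (k : Fin r → ℕ) (btil : Fin r → MvPolynomial (Fin r) (ZMod 2))
    (I : Finset (Fin r)) : phiP r k btil (cP r I) = kC r k btil I := by
  rcases eq_empty_or_singleton_or_two_le_card I with rfl | ⟨t, rfl⟩ | h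
  · rw [cP_empty, map_zero, kC_eq, Finset.sum_empty]
  · rw [cP_singleton, phiP_X_inl, kC_eq, Finset.sum_singleton, Finset.erase_singleton, kTheta,
      Finset.prod_empty, mul_one]
  · rw [cP_of_two_le h, phiP, aeval_X, Sum.elim_inr]

lemma phiP_eq_zero {r : ℕ} {k : Fin r → ℕ} (hk : ∀ i, 1 ≤ k i)
    {btil : Fin r → MvPolynomial (Fin r) (ZMod 2)}
    {btilM : Finset (Fin r) → MvPolynomial (Fin r) (ZMod 2)}
    (hbtilM : ∀ M : Finset (Fin r), yEval r k btil (btilM M) = kbM r k btil M)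
    {f : PRing r} (hf : f ∈ relIdeal r k btilM) : phiP r k btil f = 0 := by
  suffices h : relIdeal r k btilM ≤ RingHom.ker (phiP r k btil) from h hf
  rw [relIdeal, Ideal.span_le]
  rintro _ (((⟨i, rfl⟩ | ⟨J, _, rfl⟩) | ⟨K, _, rfl⟩) | ⟨H, L, _, _, rfl⟩) <;>
    rw [SetLike.mem_coe, RingHom.mem_ker]
  · dsimp only
    rw [map_pow, phiP_X_inl, ky_pow]
  · simp only [map_mul, map_prod, map_pow, phiP_X_inl, phiP_cP, prod_ky_pow_mul_kC hk]
  · simp only [map_sum, map_mul, phiP_X_inl, phiP_cP, sum_ky_mul_kC_erase]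
  · simp only [map_add, map_sum, map_mul, phiP_X_inl, phiP_cP, phiP_rename, hbtilM, kC_mul_kC]
    exact ZModModule.add_self _

lemma yEval_mul_mem_kIm {r : ℕ} {k : Fin r → ℕ} {btil : Fin r → MvPolynomial (Fin r) (ZMod 2)}
    (q : MvPolynomial (Fin r) (ZMod 2)) {x : KRing r k btil} (hx : x ∈ kIm r k btil) :
    yEval r k btil q * x ∈ kIm r k btil := by
  induction hx using Submodule.span_induction with
  | mem x hx =>
    obtain ⟨q', I, rfl⟩ := hx
    refine Submodule.subset_span ⟨q * q', I, ?_⟩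
    simp only [yEval, map_mul, mul_assoc]
  | zero => rw [mul_zero]; exact zero_mem _
  | add a b _ _ ha hb => rw [mul_add]; exact add_mem ha hb
  | smul s a _ ha => rw [mul_smul_comm]; exact Submodule.smul_mem _ s ha

lemma kC_mem_kIm {r : ℕ} (k : Fin r → ℕ) (btil : Fin r → MvPolynomial (Fin r) (ZMod 2))
    (I : Finset (Fin r)) : kC r k btil I ∈ kIm r k btil :=
  Submodule.subset_span ⟨1, I, by simp [yEval]⟩

lemma kC_mul_kC_mem_kIm {r : ℕ} (k : Fin r → ℕ) (btil : Fin r → MvPolynomial (Fin r) (ZMod 2))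
    (H L : Finset (Fin r)) : kC r k btil H * kC r k btil L ∈ kIm r k btil := by
  rw [kC_mul_kC]
  refine sum_mem fun i _ => ?_
  have h : ky r k btil i * kbM r k btil (H.erase i ∩ L) =
      yEval r k btil (X i * ∏ j ∈ H.erase i ∩ L, btil j) := by
    simp only [ky, kbM, kb, yEval, map_mul, map_prod, rename_X]
  rw [h]
  exact yEval_mul_mem_kIm _ (kC_mem_kIm k btil _)

lemma mul_mem_kIm {r : ℕ} {k : Fin r → ℕ} {btil : Fin r → MvPolynomial (Fin r) (ZMod 2)}
    {x y : KRing r k btil} (hx : x ∈ kIm r k btil) (hy : y ∈ kIm r k btil) :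
    x * y ∈ kIm r k btil := by
  induction hx using Submodule.span_induction with
  | zero => rw [zero_mul]; exact zero_mem _
  | add a b _ _ ha hb => rw [add_mul]; exact add_mem ha hb
  | smul s a _ ha => rw [smul_mul_assoc]; exact Submodule.smul_mem _ s ha
  | mem x hx =>
    obtain ⟨q, H, rfl⟩ := hx
    rw [mul_assoc]
    refine yEval_mul_mem_kIm q ?_
    induction hy using Submodule.span_induction with
    | zero => rw [mul_zero]; exact zero_mem _
    | add a b _ _ ha hb => rw [mul_add]; exact add_mem ha hb
    | smul s a _ ha => rw [mul_smul_comm]; exact Submodule.smul_mem _ s ha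
    | mem y hy =>
      obtain ⟨q', L, rfl⟩ := hy
      rw [mul_left_comm]
      exact yEval_mul_mem_kIm q' (kC_mul_kC_mem_kIm k btil H L)

/-- The span of the elements `q c_I`, with `q` a polynomial in the `Y_i`, in the quotient ring. -/
def linearSpan (r : ℕ) (k : Fin r → ℕ)
    (btilM : Finset (Fin r) → MvPolynomial (Fin r) (ZMod 2)) :
    Submodule (ZMod 2) (QRing r k btilM) :=
  Submodule.span (ZMod 2) {x | ∃ (q : MvPolynomial (Fin r) (ZMod 2)) (I : Finset (Fin r)),
    x = Ideal.Quotient.mk (relIdeal r k btilM) (rename Sum.inl q * cP r I)}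

lemma mk_rename_mul_cP_mem {r : ℕ} (k : Fin r → ℕ)
    (btilM : Finset (Fin r) → MvPolynomial (Fin r) (ZMod 2))
    (q : MvPolynomial (Fin r) (ZMod 2)) (I : Finset (Fin r)) :
    Ideal.Quotient.mk (relIdeal r k btilM) (rename Sum.inl q * cP r I) ∈
      linearSpan r k btilM :=
  Submodule.subset_span ⟨q, I, rfl⟩

lemma mk_mul_cP_mul_cP_mem {r : ℕ} (k : Fin r → ℕ)
    (btilM : Finset (Fin r) → MvPolynomial (Fin r) (ZMod 2))
    (q : MvPolynomial (Fin r) (ZMod 2)) {H : Finset (Fin r)} (hH : 2 ≤ H.card)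
    (L : Finset (Fin r)) :
    Ideal.Quotient.mk (relIdeal r k btilM) (rename Sum.inl q * (cP r H * cP r L)) ∈
      linearSpan r k btilM := by
  rcases eq_empty_or_singleton_or_two_le_card L with rfl | ⟨t, rfl⟩ | hL
  · rw [cP_empty, mul_zero, mul_zero, map_zero]
    exact zero_mem _
  · have h : rename Sum.inl q * (cP r H * cP r {t}) = rename Sum.inl (q * X t) * cP r H := by
      rw [cP_singleton, map_mul, rename_X]
      ring
    rw [h]
    exact mk_rename_mul_cP_mem k btilM _ _
  · have hS : Ideal.Quotient.mk (relIdeal r k btilM) (cP r H * cP r L) =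
        Ideal.Quotient.mk (relIdeal r k btilM) (∑ i ∈ H, (X (Sum.inl i) : PRing r) *
          rename (Sum.inl : Fin r → PVar r) (btilM ((H.erase i) ∩ L)) *
            cP r (symmDiff (H.erase i) L)) := by
      rw [Ideal.Quotient.eq, ZModModule.sub_eq_add]
      exact Ideal.subset_span (Or.inr ⟨H, L, hH, hL, rfl⟩)
    rw [map_mul, hS, ← map_mul, Finset.mul_sum, map_sum]
    refine sum_mem fun i _ => ?_
    have h : rename (Sum.inl : Fin r → PVar r) q * ((X (Sum.inl i) : PRing r) *
          rename (Sum.inl : Fin r → PVar r) (btilM ((H.erase i) ∩ L)) *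
            cP r (symmDiff (H.erase i) L)) =
        rename Sum.inl (q * X i * btilM ((H.erase i) ∩ L)) * cP r (symmDiff (H.erase i) L) := by
      rw [map_mul, map_mul, rename_X]
      ring
    rw [h]
    exact mk_rename_mul_cP_mem k btilM _ _

lemma mk_mul_mem_linearSpan {r : ℕ} {k : Fin r → ℕ}
    {btilM : Finset (Fin r) → MvPolynomial (Fin r) (ZMod 2)} (p : PRing r)
    {w : QRing r k btilM} (hw : w ∈ linearSpan r k btilM) :
    Ideal.Quotient.mk (relIdeal r k btilM) p * w ∈ linearSpan r k btilM := by
  induction p using MvPolynomial.induction_on generalizing w with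
  | C t =>
    rw [← algebraMap_eq, Ideal.Quotient.mk_algebraMap, ← Algebra.smul_def]
    exact Submodule.smul_mem _ t hw
  | add p q hp hq =>
    rw [map_add, add_mul]
    exact add_mem (hp hw) (hq hw)
  | mul_X p v hp =>
    rw [map_mul, mul_assoc]
    refine hp ?_
    induction hw using Submodule.span_induction with
    | zero => rw [mul_zero]; exact zero_mem _
    | add a b _ _ ha hb => rw [mul_add]; exact add_mem ha hb
    | smul s a _ ha => rw [mul_smul_comm]; exact Submodule.smul_mem _ s ha
    | mem x hx =>
      obtain ⟨q, I, rfl⟩ := hx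
      rw [← map_mul]
      rcases v with i | ⟨H, hH⟩
      · rw [← mul_assoc, ← rename_X (R := ZMod 2) (Sum.inl : Fin r → PVar r) i, ← map_mul]
        exact mk_rename_mul_cP_mem k btilM _ _
      · rw [← cP_of_two_le hH, mul_left_comm]
        exact mk_mul_cP_mul_cP_mem k btilM q hH I

lemma mk_mem_linearSpan {r : ℕ} {k : Fin r → ℕ}
    {btilM : Finset (Fin r) → MvPolynomial (Fin r) (ZMod 2)} {f : PRing r} (hf : f ∈ Pplus r) :
    Ideal.Quotient.mk (relIdeal r k btilM) f ∈ linearSpan r k btilM := by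
  have h : ∀ p : PRing r, Ideal.Quotient.mk (relIdeal r k btilM) (p - C (constantCoeff p)) ∈
      linearSpan r k btilM := by
    intro p
    induction p using MvPolynomial.induction_on with
    | C t =>
      rw [constantCoeff_C, sub_self, map_zero]
      exact zero_mem _
    | add p q hp hq =>
      rw [map_add, C_add, add_sub_add_comm, map_add]
      exact add_mem hp hq
    | mul_X p v _ =>
      rw [map_mul, constantCoeff_X, mul_zero, C_0, sub_zero, map_mul]
      refine mk_mul_mem_linearSpan p ?_
      rcases v with i | ⟨H, hH⟩
      · simpa [cP_singleton] using mk_rename_mul_cP_mem k btilM 1 {i}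
      · simpa [cP_of_two_le hH] using mk_rename_mul_cP_mem k btilM 1 H
  have hf' := h f
  rwa [RingHom.mem_ker.mp hf, C_0, sub_zero] at hf'

lemma mem_linearSpan_iff {r : ℕ} {k : Fin r → ℕ}
    {btilM : Finset (Fin r) → MvPolynomial (Fin r) (ZMod 2)} {x : QRing r k btilM} :
    x ∈ linearSpan r k btilM ↔ x ∈ Qplus r k btilM := by
  constructor
  · intro hx
    have h : linearSpan r k btilM ≤ (Qplus r k btilM).restrictScalars (ZMod 2) := by
      refine Submodule.span_le.mpr ?_
      rintro _ ⟨q, I, rfl⟩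
      exact Ideal.mem_map_of_mem _ (Ideal.mul_mem_left _ _ (cP_mem_Pplus I))
    exact h hx
  · intro hx
    obtain ⟨f, hf, rfl⟩ :=
      (Ideal.mem_map_iff_of_surjective _ Ideal.Quotient.mk_surjective).mp hx
    exact mk_mem_linearSpan hf

lemma mk_prod_pow_mul_cP {r : ℕ} (k : Fin r → ℕ) (hk : ∀ i, 1 ≤ k i)
    (btilM : Finset (Fin r) → MvPolynomial (Fin r) (ZMod 2)) (J : Finset (Fin r)) :
    Ideal.Quotient.mk (relIdeal r k btilM)
      ((∏ j ∈ J, (X (Sum.inl j) : PRing r) ^ (k j - 1)) * cP r J) = 0 := by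
  rcases eq_empty_or_singleton_or_two_le_card J with rfl | ⟨t, rfl⟩ | hJ
  · rw [cP_empty, mul_zero, map_zero]
  · rw [cP_singleton, Finset.prod_singleton, ← pow_succ, Nat.sub_add_cancel (hk t),
      Ideal.Quotient.eq_zero_iff_mem]
    exact Ideal.subset_span (Or.inl (Or.inl (Or.inl ⟨t, rfl⟩)))
  · rw [Ideal.Quotient.eq_zero_iff_mem]
    exact Ideal.subset_span (Or.inl (Or.inl (Or.inr ⟨J, hJ, rfl⟩)))

lemma mk_sum_X_mul_cP_erase {r : ℕ} (k : Fin r → ℕ)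
    (btilM : Finset (Fin r) → MvPolynomial (Fin r) (ZMod 2)) (K : Finset (Fin r)) :
    Ideal.Quotient.mk (relIdeal r k btilM)
      (∑ i ∈ K, (X (Sum.inl i) : PRing r) * cP r (K.erase i)) = 0 := by
  rcases Nat.lt_or_ge K.card 3 with h | h
  · suffices h0 : ∑ i ∈ K, (X (Sum.inl i) : PRing r) * cP r (K.erase i) = 0 by
      rw [h0, map_zero]
    rcases eq_empty_or_singleton_or_two_le_card K with rfl | ⟨t, rfl⟩ | hK
    · rw [Finset.sum_empty]
    · rw [Finset.sum_singleton, Finset.erase_singleton, cP_empty, mul_zero]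
    · obtain ⟨s, t, hst, rfl⟩ := Finset.card_eq_two.mp (by omega : K.card = 2)
      have ht : ({s, t} : Finset (Fin r)).erase s = {t} :=
        Finset.erase_insert (by simpa using hst)
      have hs : ({s, t} : Finset (Fin r)).erase t = {s} := by
        rw [Finset.pair_comm, Finset.erase_insert (by simpa using hst.symm)]
      rw [Finset.sum_pair hst, ht, hs, cP_singleton, cP_singleton, mul_comm]
      exact ZModModule.add_self _
  · rw [Ideal.Quotient.eq_zero_iff_mem]
    exact Ideal.subset_span (Or.inl (Or.inr ⟨K, h, rfl⟩))

/-- A linear map on `C` sending `q C_I` to `q c_I`. -/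
lemma exists_linearMap_KRing_QRing {r : ℕ} {k : Fin r → ℕ} (hk : ∀ i, 1 ≤ k i)
    (btil : Fin r → MvPolynomial (Fin r) (ZMod 2))
    (btilM : Finset (Fin r) → MvPolynomial (Fin r) (ZMod 2)) :
    ∃ G : KRing r k btil →ₗ[ZMod 2] QRing r k btilM,
      ∀ (q : MvPolynomial (Fin r) (ZMod 2)) (I : Finset (Fin r)),
        G (yEval r k btil q * kC r k btil I) =
          Ideal.Quotient.mk (relIdeal r k btilM) (rename Sum.inl q * cP r I) := by
  let y : Fin r → QRing r k btilM := fun i => Ideal.Quotient.mk _ (X (Sum.inl i))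
  let c : Finset (Fin r) → QRing r k btilM := fun I => Ideal.Quotient.mk _ (cP r I)
  have hy : ∀ i, y i ^ k i = 0 := by
    intro i
    rw [← map_pow, Ideal.Quotient.eq_zero_iff_mem]
    exact Ideal.subset_span (Or.inl (Or.inl (Or.inl ⟨i, rfl⟩)))
  have hR : ∀ J : Finset (Fin r), (∏ j ∈ J, y j ^ (k j - 1)) * c J = 0 := by
    intro J
    simpa only [map_mul, map_prod, map_pow] using mk_prod_pow_mul_cP k hk btilM J
  have hD : ∀ K : Finset (Fin r), ∑ i ∈ K, y i * c (K.erase i) = 0 := by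
    intro K
    simpa only [map_sum, map_mul] using mk_sum_X_mul_cP_erase k btilM K
  obtain ⟨G, hG⟩ := exists_linearMap_kC btil hy hR hD
  refine ⟨G, fun q I => ?_⟩
  have hq : aeval y = (Ideal.Quotient.mkₐ (ZMod 2) (relIdeal r k btilM)).comp
      (rename Sum.inl) := by
    ext i
    simp [y]
  rw [hG, hq, map_mul]
  rfl

/-- The map `P/⟨relations⟩ → C` induced by `Y_i ↦ y_i`, `c_I ↦ C_I`. -/
def phiQ {r : ℕ} {k : Fin r → ℕ} (hk : ∀ i, 1 ≤ k i)
    {btil : Fin r → MvPolynomial (Fin r) (ZMod 2)}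
    {btilM : Finset (Fin r) → MvPolynomial (Fin r) (ZMod 2)}
    (hbtilM : ∀ M : Finset (Fin r), yEval r k btil (btilM M) = kbM r k btil M) :
    QRing r k btilM →ₐ[ZMod 2] KRing r k btil :=
  Ideal.Quotient.liftₐ _ (phiP r k btil) fun _ hf => phiP_eq_zero hk hbtilM hf

lemma phiQ_mk {r : ℕ} {k : Fin r → ℕ} (hk : ∀ i, 1 ≤ k i)
    {btil : Fin r → MvPolynomial (Fin r) (ZMod 2)}
    {btilM : Finset (Fin r) → MvPolynomial (Fin r) (ZMod 2)}
    (hbtilM : ∀ M : Finset (Fin r), yEval r k btil (btilM M) = kbM r k btil M) (f : PRing r) :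
    phiQ hk hbtilM (Ideal.Quotient.mk _ f) = phiP r k btil f :=
  rfl

lemma map_phiQ_linearSpan {r : ℕ} {k : Fin r → ℕ} (hk : ∀ i, 1 ≤ k i)
    {btil : Fin r → MvPolynomial (Fin r) (ZMod 2)}
    {btilM : Finset (Fin r) → MvPolynomial (Fin r) (ZMod 2)}
    (hbtilM : ∀ M : Finset (Fin r), yEval r k btil (btilM M) = kbM r k btil M) :
    (linearSpan r k btilM).map (phiQ hk hbtilM).toLinearMap = kIm r k btil := by
  have h : ∀ (q : MvPolynomial (Fin r) (ZMod 2)) (I : Finset (Fin r)),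
      phiQ hk hbtilM (Ideal.Quotient.mk _ (rename Sum.inl q * cP r I)) =
        yEval r k btil q * kC r k btil I := fun q I => by
    rw [phiQ_mk, map_mul, phiP_rename, phiP_cP]
  rw [linearSpan, Submodule.map_span, kIm]
  congr 1
  ext x
  constructor
  · rintro ⟨_, ⟨q, I, rfl⟩, rfl⟩
    exact ⟨q, I, h q I⟩
  · rintro ⟨q, I, rfl⟩
    exact ⟨_, ⟨q, I, rfl⟩, h q I⟩

lemma phiQ_injOn_linearSpan {r : ℕ} {k : Fin r → ℕ} (hk : ∀ i, 1 ≤ k i)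
    {btil : Fin r → MvPolynomial (Fin r) (ZMod 2)}
    {btilM : Finset (Fin r) → MvPolynomial (Fin r) (ZMod 2)}
    (hbtilM : ∀ M : Finset (Fin r), yEval r k btil (btilM M) = kbM r k btil M) :
    Set.InjOn (phiQ hk hbtilM) (linearSpan r k btilM) := by
  obtain ⟨G, hG⟩ := exists_linearMap_KRing_QRing hk btil btilM
  have hleft : Set.LeftInvOn G (phiQ hk hbtilM) (linearSpan r k btilM) := by
    intro x hx
    induction hx using Submodule.span_induction with
    | mem x hx =>
      obtain ⟨q, I, rfl⟩ := hx
      rw [phiQ_mk, map_mul, phiP_rename, phiP_cP, hG]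
    | zero => rw [map_zero, map_zero]
    | add a b _ _ ha hb => rw [map_add, map_add, ha, hb]
    | smul s a _ ha => rw [map_smul, map_smul, ha]
  exact hleft.injOn

/-- `Im δ` is a non-unital `𝔽₂`-subalgebra of `C` (an `A`-submodule closed
under the product of `C`), and the assignment `Y_i ↦ y_i`, `c_I ↦ C_I` induces an
isomorphism of non-unital `𝔽₂`-algebras
`P⁺/⟨Y_i^{k_i}, R̃_J, D̃_K, S̃_{H,L}⟩ ≅ Im δ`,
where `b̃_M` is any fixed polynomial in the `Y_i` mapping to `b_M` under `Y_i ↦ y_i`. -/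
theorem statement4 (r : ℕ) (hr : 1 ≤ r) (k : Fin r → ℕ) (hk : ∀ i, 1 ≤ k i)
    (btil : Fin r → MvPolynomial (Fin r) (ZMod 2))
    (btilM : Finset (Fin r) → MvPolynomial (Fin r) (ZMod 2))
    (hbtilM : ∀ M : Finset (Fin r), yEval r k btil (btilM M) = kbM r k btil M) :
    (∀ q : MvPolynomial (Fin r) (ZMod 2), ∀ x ∈ kIm r k btil,
        yEval r k btil q * x ∈ kIm r k btil) ∧
    (∀ x ∈ kIm r k btil, ∀ y ∈ kIm r k btil, x * y ∈ kIm r k btil) ∧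
    ∃ e : ↥(Qplus r k btilM) ≃ₗ[ZMod 2] ↥(kIm r k btil),
      (∀ x y : ↥(Qplus r k btilM),
        (e ⟨(x : QRing r k btilM) * (y : QRing r k btilM),
            (Qplus r k btilM).mul_mem_left _ y.2⟩ : KRing r k btil) =
          (e x : KRing r k btil) * (e y : KRing r k btil)) ∧
      (∀ (f : PRing r) (hf : f ∈ Pplus r),
        (e ⟨Ideal.Quotient.mk (relIdeal r k btilM) f,
            Ideal.mem_map_of_mem _ hf⟩ : KRing r k btil) = phiP r k btil f) := by
  have hmem : ∀ x : ↥(Qplus r k btilM), phiQ hk hbtilM x ∈ kIm r k btil := fun x => by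
    rw [← map_phiQ_linearSpan hk hbtilM]
    exact Submodule.mem_map_of_mem (mem_linearSpan_iff.mpr x.2)
  refine ⟨fun q x hx => yEval_mul_mem_kIm q hx, fun x hx y hy => mul_mem_kIm hx hy,
    LinearEquiv.ofBijective (((phiQ hk hbtilM).toLinearMap ∘ₗ
      (Qplus r k btilM).subtype.restrictScalars (ZMod 2)).codRestrict (kIm r k btil) hmem)
      ⟨fun x y hxy => ?_, fun z => ?_⟩, fun x y => ?_, fun f hf => ?_⟩
  · exact Subtype.ext (phiQ_injOn_linearSpan hk hbtilM (mem_linearSpan_iff.mpr x.2)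
      (mem_linearSpan_iff.mpr y.2) (congrArg Subtype.val hxy))
  · obtain ⟨w, hw, hwz⟩ := (map_phiQ_linearSpan hk hbtilM).ge z.2
    exact ⟨⟨w, mem_linearSpan_iff.mp hw⟩, Subtype.ext hwz⟩
  · exact map_mul (phiQ hk hbtilM) (x : QRing r k btilM) y
  · exact phiQ_mk hk hbtilM f

end
end
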